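/- arXiv:2311.04749 — 10 statements merged into one kernel-verified Lean document; each statement's English description precedes it below -/
import Mathlib

section
/- Let f be a feasible circulation. Then f has minimum cost among all feasible circulations (i.e., cost(f) ≤ cost(g) for every feasible circulation g) if and only if the residual graph of f contains no negative cycle. -/
/-!
STATEMENT 0: A feasible circulation `f` has minimum cost among all feasible
circulations iff the residual graph of `f` contains no negative (simple) cycle.
-/

variable {V : Type*}

/-- `L` is a simple cycle of the digraph with adjacency relation `A`:
a nonempty list of pairwise distinct vertices such that there is an edge
from each vertex to the next (cyclically). -/
def IsSimpleCycle (A : V → V → Prop) (L : List V) : Prop :=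
  L ≠ [] ∧ L.Nodup ∧
    ∀ i : Fin L.length, A (L.get i) (L.get ⟨(i + 1) % L.length, Nat.mod_lt _ i.pos⟩)

/-- Cost of a (simple) cycle `L` with respect to edge costs `c`. -/
def cycleCost (c : V → V → ℝ) (L : List V) : ℝ :=
  ∑ i : Fin L.length, c (L.get i) (L.get ⟨(i + 1) % L.length, Nat.mod_lt _ i.pos⟩)

/-- Adjacency of the residual graph of a flow `f` with capacities `cap`:
a forward edge `x → y` when `f x y < cap x y`, and a backward edge `x → y`
when `0 < f y x`. -/
def ResAdj (cap f : V → V → ℕ) (x y : V) : Prop :=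
  f x y < cap x y ∨ 0 < f y x

/-- Cost of a residual edge `x → y`: `-(c y x)` for a backward edge
(i.e. when `0 < f y x`), and `c x y` otherwise (forward edge). -/
def resCost (c : V → V → ℝ) (f : V → V → ℕ) (x y : V) : ℝ :=
  if 0 < f y x then -(c y x) else c x y

/-- `f` is a feasible circulation: capacity constraints and flow conservation. -/
def IsCirculation [Fintype V] (cap f : V → V → ℕ) : Prop :=
  (∀ x y, f x y ≤ cap x y) ∧ ∀ x, ∑ y, f x y = ∑ y, f y x

/-- Total cost of a flow `f`. -/
def flowCost [Fintype V] (c : V → V → ℝ) (f : V → V → ℕ) : ℝ :=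
  ∑ x, ∑ y, c x y * (f x y : ℝ)

def cnx (L : List V) (i : Fin L.length) : Fin L.length := ⟨(i + 1) % L.length, Nat.mod_lt _ i.pos⟩

lemma cnx_bij (L : List V) : Function.Bijective (cnx L) := by
  rw [← Finite.injective_iff_bijective]
  rintro ⟨i, hi⟩ ⟨j, hj⟩ h
  simp only [cnx, Fin.mk.injEq] at h ⊢
  rcases Nat.lt_or_ge (i+1) L.length with h1 | h1 <;>
  rcases Nat.lt_or_ge (j+1) L.length with h2 | h2
  · rw [Nat.mod_eq_of_lt h1, Nat.mod_eq_of_lt h2] at h; omega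
  · have : j + 1 = L.length := by omega
    rw [Nat.mod_eq_of_lt h1, this, Nat.mod_self] at h; omega
  · have : i + 1 = L.length := by omega
    rw [Nat.mod_eq_of_lt h2, this, Nat.mod_self] at h; omega
  · omega

def ce [DecidableEq V] (L : List V) (x y : V) : ℕ :=
  ∑ i : Fin L.length, if L.get i = x ∧ L.get (cnx L i) = y then 1 else 0

lemma ce_cons [Fintype V] [DecidableEq V] (L : List V) (x : V) :
    ∑ y, ce L x y = ∑ y, ce L y x := by
  have h1 : ∑ y, ce L x y = ∑ i : Fin L.length, if L.get i = x then 1 else 0 := by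
    unfold ce
    rw [Finset.sum_comm]
    refine Finset.sum_congr rfl fun i _ => ?_
    by_cases h : L.get i = x <;> simp only [h, true_and, false_and, if_true, if_false] <;> simp
  have h2 : ∑ y, ce L y x = ∑ i : Fin L.length, if L.get (cnx L i) = x then 1 else 0 := by
    unfold ce
    rw [Finset.sum_comm]
    refine Finset.sum_congr rfl fun i _ => ?_
    by_cases h : L.get (cnx L i) = x <;> simp only [h, and_true, and_false, if_true, if_false] <;> simp
  rw [h1, h2]
  exact ((cnx_bij L).sum_comp (fun i => if L.get i = x then 1 else 0)).symm

lemma ce_le [DecidableEq V] (L : List V) (hL : L.Nodup) (x y : V) : ce L x y ≤ 1 := by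
  unfold ce
  rw [← Finset.card_filter, Finset.card_le_one]
  intro a ha b hb
  simp only [Finset.mem_filter, Finset.mem_univ, true_and] at ha hb
  exact (List.nodup_iff_injective_get.1 hL) (ha.1.trans hb.1.symm)

lemma ce_adj [DecidableEq V] {A : V → V → Prop} {L : List V} (hL : IsSimpleCycle A L) {x y : V}
    (h : 0 < ce L x y) : A x y := by
  unfold ce at h
  obtain ⟨i, _, hi⟩ := Finset.exists_ne_zero_of_sum_ne_zero h.ne'
  have hi' : L.get i = x ∧ L.get (cnx L i) = y := by
    by_contra hc
    exact hi (if_neg hc)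
  rw [← hi'.1, ← hi'.2]
  exact hL.2.2 i

lemma ce_cost [Fintype V] [DecidableEq V] (L : List V) (w : V → V → ℝ) :
    ∑ x, ∑ y, w x y * (ce L x y : ℝ) = cycleCost w L := by
  have : ∀ x y, w x y * (ce L x y : ℝ) =
      ∑ i : Fin L.length, if L.get i = x then (if L.get (cnx L i) = y then w x y else 0) else 0 := by
    intro x y
    unfold ce
    push_cast
    rw [Finset.mul_sum]
    refine Finset.sum_congr rfl fun i _ => ?_
    rw [← ite_and]
    simp
  simp_rw [this]
  rw [Finset.sum_congr rfl fun x _ => Finset.sum_comm, Finset.sum_comm]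
  unfold cycleCost
  refine Finset.sum_congr rfl fun i _ => ?_
  rw [Finset.sum_eq_single (L.get i)]
  · simp only [if_true]
    rw [Finset.sum_ite_eq]
    simp [cnx]
  · intro b _ hb
    simp only [if_neg hb.symm, Finset.sum_const_zero]
  · simp

lemma exists_cycle [Fintype V] (r : V → V → ℕ)
    (hr : ∀ x, ∑ y, r x y = ∑ y, r y x) (a b : V) (hab : 0 < r a b) :
    ∃ L, IsSimpleCycle (fun x y => 0 < r x y) L := by
  have hs : ∀ x : V, ∃ y, (∃ z, 0 < r x z) → 0 < r x y := fun x => by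
    by_cases h : ∃ z, 0 < r x z
    · exact ⟨h.choose, fun _ => h.choose_spec⟩
    · exact ⟨x, fun h' => absurd h' h⟩
  choose s hs using hs
  have hout : ∀ x y, 0 < r x y → ∃ z, 0 < r y z := by
    intro x y h
    by_contra hc
    push Not at hc
    have h0 : ∑ z, r y z = 0 := Finset.sum_eq_zero fun z _ => by have := hc z; omega
    rw [hr y, Finset.sum_eq_zero_iff] at h0
    have := h0 x (Finset.mem_univ _)
    omega
  have hit : ∀ n, 0 < r (s^[n] a) (s^[n+1] a) := by
    intro n
    rw [Function.iterate_succ_apply']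
    apply hs
    induction n with
    | zero => exact ⟨b, hab⟩
    | succ n ih =>
      rw [Function.iterate_succ_apply']
      exact hout _ _ (hs _ ih)
  obtain ⟨m, n, hmn, he⟩ : ∃ m n, m < n ∧ s^[m] a = s^[n] a := by
    obtain ⟨m, n, hne, he⟩ := Finite.exists_ne_map_eq_of_infinite (fun n => s^[n] a)
    rcases lt_or_gt_of_ne hne with h | h
    · exact ⟨m, n, h, he⟩
    · exact ⟨n, m, h, he.symm⟩
  set p := s^[m] a with hp
  have hper : Function.IsPeriodicPt s (n - m) p := by
    unfold Function.IsPeriodicPt Function.IsFixedPt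
    rw [hp, ← Function.iterate_add_apply, Nat.sub_add_cancel hmn.le, ← he]
  have hpos : 0 < Function.minimalPeriod s p := hper.minimalPeriod_pos (by omega)
  have hit' : ∀ k, 0 < r (s^[k] p) (s^[k+1] p) := by
    intro k
    rw [hp, ← Function.iterate_add_apply, ← Function.iterate_add_apply]
    have := hit (k + m)
    rwa [show k + m + 1 = k + 1 + m by omega] at this
  refine ⟨(List.range (Function.minimalPeriod s p)).map (fun k => s^[k] p), ?_, ?_, ?_⟩
  · intro h
    have := congrArg List.length h
    simp at this
    omega
  · refine List.Nodup.map_on ?_ List.nodup_range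
    intro x hx y hy hxy
    rw [List.mem_range] at hx hy
    exact (Function.iterate_eq_iterate_iff_of_lt_minimalPeriod hx hy).1 hxy
  · rintro ⟨i, hi⟩
    simp only [List.get_eq_getElem, List.getElem_map, List.getElem_range, List.length_map,
      List.length_range, Function.iterate_mod_minimalPeriod_eq]
    exact hit' i

lemma circ_nonneg [Fintype V] [DecidableEq V] (A : V → V → Prop) (w : V → V → ℝ)
    (hw : ∀ L, IsSimpleCycle A L → 0 ≤ cycleCost w L) (N : ℕ) :
    ∀ r : V → V → ℕ, (∑ x, ∑ y, r x y ≤ N) → (∀ x y, 0 < r x y → A x y) →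
      (∀ x, ∑ y, r x y = ∑ y, r y x) → 0 ≤ ∑ x, ∑ y, w x y * (r x y : ℝ) := by
  induction N with
  | zero =>
    intro r hN _ _
    have h0 : ∀ x y, r x y = 0 := by
      intro x y
      have h1 := Nat.le_zero.1 hN
      rw [Finset.sum_eq_zero_iff] at h1
      have h2 := h1 x (Finset.mem_univ _)
      rw [Finset.sum_eq_zero_iff] at h2
      exact h2 y (Finset.mem_univ _)
    simp [h0]
  | succ N ih =>
    intro r hN hA hc
    by_cases hz : ∃ a b, 0 < r a b
    · obtain ⟨a, b, hab⟩ := hz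
      obtain ⟨L, hL⟩ := exists_cycle r hc a b hab
      have hle : ∀ x y, ce L x y ≤ r x y := by
        intro x y
        have h1 := ce_le L hL.2.1 x y
        by_cases h : 0 < ce L x y
        · have := ce_adj hL h
          omega
        · omega
      have hLA : IsSimpleCycle A L := ⟨hL.1, hL.2.1, fun i => hA _ _ (hL.2.2 i)⟩
      have hsplit : ∀ x y, r x y = (r x y - ce L x y) + ce L x y := fun x y => by
        have := hle x y; omega
      have htot : ∑ x, ∑ y, r x y = ∑ x, ∑ y, (r x y - ce L x y) + ∑ x, ∑ y, ce L x y := by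
        rw [← Finset.sum_add_distrib]
        refine Finset.sum_congr rfl fun x _ => ?_
        rw [← Finset.sum_add_distrib]
        exact Finset.sum_congr rfl fun y _ => hsplit x y
      have hpos : 0 < ∑ x, ∑ y, ce L x y := by
        have h0 : 0 < L.length := List.length_pos_iff.2 hL.1
        have hx : 0 < ce L (L.get ⟨0, h0⟩) (L.get (cnx L ⟨0, h0⟩)) := by
          unfold ce
          refine Finset.sum_pos' (fun _ _ => Nat.zero_le _) ⟨⟨0, h0⟩, Finset.mem_univ _, ?_⟩
          simp
        refine Finset.sum_pos' (fun _ _ => Nat.zero_le _) ⟨L.get ⟨0, h0⟩, Finset.mem_univ _, ?_⟩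
        exact Finset.sum_pos' (fun _ _ => Nat.zero_le _) ⟨_, Finset.mem_univ _, hx⟩
      have h1 := ih (fun x y => r x y - ce L x y) (by omega)
        (fun x y h => hA x y (by omega)) (by
          intro x
          have e1 : ∑ y, r x y = ∑ y, (r x y - ce L x y) + ∑ y, ce L x y := by
            rw [← Finset.sum_add_distrib]
            exact Finset.sum_congr rfl fun y _ => hsplit x y
          have e2 : ∑ y, r y x = ∑ y, (r y x - ce L y x) + ∑ y, ce L y x := by
            rw [← Finset.sum_add_distrib]
            exact Finset.sum_congr rfl fun y _ => hsplit y x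
          have := hc x
          have := ce_cons L x
          omega)
      have h2 := hw L hLA
      rw [← ce_cost] at h2
      have h3 : ∑ x, ∑ y, w x y * (r x y : ℝ) =
          ∑ x, ∑ y, w x y * ((r x y - ce L x y : ℕ) : ℝ) + ∑ x, ∑ y, w x y * (ce L x y : ℝ) := by
        rw [← Finset.sum_add_distrib]
        refine Finset.sum_congr rfl fun x _ => ?_
        rw [← Finset.sum_add_distrib]
        refine Finset.sum_congr rfl fun y _ => ?_
        rw [Nat.cast_sub (hle x y)]
        ring
      rw [h3]
      exact add_nonneg h1 h2
    · push Not at hz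
      have h0 : ∀ x y, r x y = 0 := fun x y => Nat.le_zero.1 (hz x y)
      simp [h0]

/-- Swapping summation order lets one compare two double sums up to an antisymmetric part. -/
lemma sum_swap_eq [Fintype V] (F G P : V → V → ℝ) (h : ∀ x y, F x y = G x y + (P x y - P y x)) :
    ∑ x, ∑ y, F x y = ∑ x, ∑ y, G x y := by
  have : ∑ x, ∑ y, P y x = ∑ x, ∑ y, P x y := Finset.sum_comm
  simp_rw [h, Finset.sum_add_distrib, Finset.sum_sub_distrib, this]
  ring

/-- Conservation passes along an equality of net flows. -/
lemma cons_of_net [Fintype V] (g f e : V → V → ℕ)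
    (h : ∀ x y, g x y + f y x + e y x = g y x + f x y + e x y)
    (hf : ∀ x, ∑ y, f x y = ∑ y, f y x) (he : ∀ x, ∑ y, e x y = ∑ y, e y x) (x : V) :
    ∑ y, g x y = ∑ y, g y x := by
  have h1 : ∑ y, (g x y + f y x + e y x) = ∑ y, (g y x + f x y + e x y) :=
    Finset.sum_congr rfl fun y _ => h x y
  simp only [Finset.sum_add_distrib] at h1
  have := hf x
  have := he x
  omega

theorem negative_cycle_optimality_conditions [Fintype V] [DecidableEq V]
    (c : V → V → ℝ) (cap : V → V → ℕ)
    (hloop : ∀ x, cap x x = 0)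
    (hanti : ∀ x y, x ≠ y → cap x y = 0 ∨ cap y x = 0)
    (f : V → V → ℕ) (hf : IsCirculation cap f) :
    (∀ g, IsCirculation cap g → flowCost c f ≤ flowCost c g) ↔
      ¬ ∃ L : List V, IsSimpleCycle (ResAdj cap f) L ∧ cycleCost (resCost c f) L < 0 := by
  obtain ⟨hfc, hfk⟩ := hf
  have hanti' : ∀ x y, cap x y = 0 ∨ cap y x = 0 := by
    intro x y
    by_cases h : x = y
    · subst h; exact Or.inl (hloop x)
    · exact hanti x y h
  constructor
  · rintro hmin ⟨L, hL, hneg⟩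
    have hadj : ∀ x y, 0 < ce L x y → ResAdj cap f x y := fun x y h => ce_adj hL h
    have hle1 := ce_le L hL.2.1
    let g : V → V → ℕ := fun x y => if cap x y = 0 then 0 else f x y + ce L x y - ce L y x
    -- the situation on a pair whose first orientation has zero capacity
    have key : ∀ x y, cap x y = 0 → f x y = 0 ∧ (0 < ce L x y → 0 < f y x) ∧
        (0 < ce L y x → f y x < cap y x) := by
      intro x y h
      have h1 := hfc x y
      refine ⟨by omega, fun h2 => ?_, fun h2 => ?_⟩
      · rcases hadj x y h2 with h3 | h3 <;> omega
      · rcases hadj y x h2 with h3 | h3 <;> omega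
    have hg : IsCirculation cap g := by
      refine ⟨fun x y => ?_, cons_of_net g f (ce L) (fun x y => ?_) hfk (ce_cons L)⟩
      · simp only [g]
        split_ifs with h
        · omega
        · have := key y x ((hanti' x y).resolve_left h)
          have := hle1 x y
          have := hfc x y
          omega
      · simp only [g]
        have := hle1 x y
        have := hle1 y x
        have := hfc x y
        have := hfc y x
        split_ifs with h1 h2 h2
        · have := key x y h1
          have := key y x h2
          omega
        · have := key x y h1
          omega
        · have := key y x h2
          omega
        · rcases hanti' x y with h | h <;> omega
    have h1 := hmin g hg
    have h2 : flowCost c g = flowCost c f + cycleCost (resCost c f) L := by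
      rw [← ce_cost]
      unfold flowCost
      rw [← Finset.sum_add_distrib]
      simp_rw [← Finset.sum_add_distrib]
      refine sum_swap_eq _ _ (fun x y => if cap y x = 0 then 0 else c y x * (ce L x y : ℝ)) ?_
      intro x y
      simp only [g, resCost]
      have a1 := hle1 x y
      have a2 := hle1 y x
      by_cases hx : cap x y = 0
      · have k1 := key x y hx
        by_cases hy : cap y x = 0
        · have k2 := key y x hy
          have z1 : ce L x y = 0 := by omega
          have z2 : ce L y x = 0 := by omega
          simp [hx, hy, z1, z2, k1.1]
        · by_cases hp : 0 < f y x
          · simp [hx, hy, hp, k1.1]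
          · have z1 : ce L x y = 0 := by omega
            simp [hx, hy, k1.1, z1]
      · have hy := (hanti' x y).resolve_left hx
        have k2 := key y x hy
        have : ce L y x ≤ f x y + ce L x y := by omega
        have hp : ¬ 0 < f y x := by omega
        simp only [if_neg hx, if_pos hy, if_neg hp, Nat.cast_sub this]
        push_cast
        ring
    linarith
  · rintro hno g ⟨hgc, hgk⟩
    have hw : ∀ L, IsSimpleCycle (ResAdj cap f) L → 0 ≤ cycleCost (resCost c f) L := by
      intro L hL
      by_contra hc
      exact hno ⟨L, hL, not_le.1 hc⟩
    let r : V → V → ℕ := fun x y => (g x y - f x y) + (f y x - g y x)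
    have hrk : ∀ x, ∑ y, r x y = ∑ y, r y x := by
      intro x
      have h1 : ∑ y, (r x y + (g y x + f x y)) = ∑ y, (r y x + (g x y + f y x)) := by
        refine Finset.sum_congr rfl fun y _ => ?_
        simp only [r]
        omega
      simp only [Finset.sum_add_distrib] at h1
      have := hfk x
      have := hgk x
      omega
    have hr := circ_nonneg (ResAdj cap f) (resCost c f) hw _ r le_rfl (by
      intro x y h
      simp only [r] at h
      have := hgc x y
      unfold ResAdj
      omega) hrk
    have h2 : flowCost c g = flowCost c f + ∑ x, ∑ y, resCost c f x y * (r x y : ℝ) := by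
      unfold flowCost
      rw [← Finset.sum_add_distrib]
      simp_rw [← Finset.sum_add_distrib]
      refine sum_swap_eq _ _ (fun x y => c y x * ((f y x - g y x : ℕ) : ℝ)) ?_
      intro x y
      have b1 := hfc x y
      have b2 := hfc y x
      have b3 := hgc x y
      have b4 := hgc y x
      have hd : (g x y : ℝ) + ((f x y - g x y : ℕ) : ℝ) = f x y + ((g x y - f x y : ℕ) : ℝ) := by
        norm_cast
        omega
      simp only [r, resCost]
      split_ifs with hp
      · have z : cap x y = 0 := (hanti' x y).resolve_right (by omega)
        have z1 : g x y = 0 := by omega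
        have z2 : f x y = 0 := by omega
        simp [z1, z2]
      · have z : f y x - g y x = 0 := by omega
        rw [z]
        push_cast
        linear_combination c x y * hd
    linarith
end

section
/- Assume unit capacities (cap x y ≤ 1 for all x, y) and let s ∈ V. Let f be a feasible circulation and suppose every simple cycle of the support digraph of f (the directed graph with an edge x → y whenever f x y = 1) passes through s. Then, setting K = ∑_y f s y, there exist exactly K simple cycles of the support digraph, pairwise edge-disjoint, each containing the vertex s, whose edge sets partition the support {(x, y) : f x y = 1}. -/
/-!
STATEMENT 1: Under unit capacities, if every simple cycle of the support
digraph of a feasible circulation `f` passes through `s`, then with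
`K = ∑ y, f s y` there are exactly `K` pairwise edge-disjoint simple cycles
of the support digraph, each containing `s`, whose edge sets partition the
support of `f`.
-/

variable {V : Type*}

/-- The edge set of the cycle with vertex list `L`. -/
def cycleEdges [DecidableEq V] (L : List V) : Finset (V × V) :=
  Finset.image
    (fun i : Fin L.length => (L.get i, L.get ⟨(i + 1) % L.length, Nat.mod_lt _ i.pos⟩))
    Finset.univ

theorem mem_cycleEdges_iff [DecidableEq V] {L : List V} (hL : L.Nodup) (x y : V) :
    (x, y) ∈ cycleEdges L ↔ x ∈ L ∧ y = L.formPerm x := by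
  unfold cycleEdges
  simp only [Finset.mem_image, Finset.mem_univ, true_and, Prod.mk.injEq]
  constructor
  · rintro ⟨i, rfl, rfl⟩
    refine ⟨List.get_mem _ _, ?_⟩
    have := List.formPerm_apply_getElem L hL i.1 i.2
    simp only [List.get_eq_getElem]
    exact this.symm
  · rintro ⟨hx, rfl⟩
    obtain ⟨i, hi, rfl⟩ := List.getElem_of_mem hx
    refine ⟨⟨i, hi⟩, rfl, ?_⟩
    have := List.formPerm_apply_getElem L hL i hi
    simp only [List.get_eq_getElem]
    exact this.symm

theorem sum_out_aux [Fintype V] [DecidableEq V] {L : List V} (hL : L.Nodup) (x : V) :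
    ∑ y, (if (x, y) ∈ cycleEdges L then 1 else 0 : ℕ) = if x ∈ L then 1 else 0 := by
  simp only [mem_cycleEdges_iff hL]
  by_cases h : x ∈ L <;> simp [h]

theorem sum_in_aux [Fintype V] [DecidableEq V] {L : List V} (hL : L.Nodup) (x : V) :
    ∑ y, (if (y, x) ∈ cycleEdges L then 1 else 0 : ℕ) = if x ∈ L then 1 else 0 := by
  have key : ∀ y, (y, x) ∈ cycleEdges L ↔ x ∈ L ∧ y = L.formPerm⁻¹ x := by
    intro y
    rw [mem_cycleEdges_iff hL, Equiv.Perm.eq_inv_iff_eq]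
    constructor
    · rintro ⟨h, rfl⟩
      exact ⟨List.formPerm_apply_mem_of_mem h, rfl⟩
    · rintro ⟨h, rfl⟩
      exact ⟨List.mem_of_formPerm_apply_mem h, rfl⟩
  simp only [key]
  by_cases h : x ∈ L <;> simp [h]

theorem exists_cycle_aux [Fintype V] (A : V → V → Prop)
    (hA : ∀ x y, A x y → ∃ z, A y z) (a b : V) (hab : A a b) :
    ∃ L, IsSimpleCycle A L := by
  classical
  let g : V → V := fun x => if h : ∃ z, A x z then h.choose else x
  have hg : ∀ x, (∃ z, A x z) → A x (g x) := by
    intro x h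
    simp only [g, dif_pos h]
    exact h.choose_spec
  have hit : ∀ n, A (g^[n] b) (g^[n+1] b) := by
    intro n
    induction n with
    | zero => exact hg b (hA a b hab)
    | succ k ih =>
      rw [Function.iterate_succ_apply' g (k+1)]
      exact hg _ (hA _ _ ih)
  obtain ⟨m, n, hne, heq⟩ := Finite.exists_ne_map_eq_of_infinite (fun n : ℕ => g^[n] b)
  wlog hlt : m < n generalizing m n
  · exact this n m hne.symm heq.symm (by omega)
  have hp : g^[m] b ∈ Function.periodicPts g := by
    refine ⟨n - m, by omega, ?_⟩
    rw [Function.IsPeriodicPt, Function.IsFixedPt, ← Function.iterate_add_apply, heq]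
    congr 2; omega
  have hit2 : ∀ k, A (g^[k] (g^[m] b)) (g^[k+1] (g^[m] b)) := by
    intro k
    rw [← Function.iterate_add_apply, ← Function.iterate_add_apply]
    have := hit (k + m)
    rwa [show k + m + 1 = k + 1 + m by omega] at this
  generalize g^[m] b = z at hp hit2
  have hpos := Function.minimalPeriod_pos_of_mem_periodicPts hp
  refine ⟨(List.range (Function.minimalPeriod g z)).map (fun i => g^[i] z), ?_, ?_, ?_⟩
  · simp; omega
  · refine List.Nodup.map_on ?_ List.nodup_range
    intro i hi j hj h
    rw [List.mem_range] at hi hj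
    exact (Function.iterate_injOn_Iio_minimalPeriod (f := g) (x := z)) hi hj h
  · rintro ⟨i, hi⟩
    simp only [List.get_eq_getElem, List.getElem_map, List.getElem_range, List.length_map,
      List.length_range]
    rw [Function.iterate_mod_minimalPeriod_eq]
    exact hit2 i

theorem decomp_aux [Fintype V] [DecidableEq V] (s : V) (K : ℕ) :
    ∀ f : V → V → ℕ, (∀ x y, f x y ≤ 1) → (∀ x, ∑ y, f x y = ∑ y, f y x) →
    (∀ L : List V, IsSimpleCycle (fun x y => f x y = 1) L → s ∈ L) → ∑ y, f s y = K →
    ∃ Γ : Fin K → List V,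
      (∀ i, IsSimpleCycle (fun x y => f x y = 1) (Γ i)) ∧
      (∀ i, s ∈ Γ i) ∧
      (∀ i j, i ≠ j → Disjoint (cycleEdges (Γ i)) (cycleEdges (Γ j))) ∧
      Finset.univ.biUnion (fun i => cycleEdges (Γ i)) =
        Finset.univ.filter (fun p : V × V => f p.1 p.2 = 1) := by
  have hedge : ∀ (f : V → V → ℕ) (L : List V), IsSimpleCycle (fun x y => f x y = 1) L →
      ∀ x y, (x, y) ∈ cycleEdges L → f x y = 1 := by
    intro f L hL x y h
    unfold cycleEdges at h
    simp only [Finset.mem_image, Finset.mem_univ, true_and, Prod.mk.injEq] at h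
    obtain ⟨i, rfl, rfl⟩ := h
    exact hL.2.2 i
  have hcyc : ∀ f : V → V → ℕ, (∀ x y, f x y ≤ 1) → (∀ x, ∑ y, f x y = ∑ y, f y x) →
      ∀ a b, f a b = 1 → ∃ L, IsSimpleCycle (fun x y => f x y = 1) L := by
    intro f h1 hc a b hab
    refine exists_cycle_aux _ ?_ a b hab
    intro x y hxy
    by_contra! hno
    have h0 : ∑ z, f y z = 0 := by
      refine Finset.sum_eq_zero fun z _ => ?_
      have := h1 y z
      have := hno z
      omega
    rw [hc y] at h0
    have := (Finset.sum_eq_zero_iff.mp h0) x (Finset.mem_univ _)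
    omega
  induction K with
  | zero =>
    intro f h1 hc ht hK
    refine ⟨Fin.elim0, fun i => i.elim0, fun i => i.elim0, fun i => i.elim0, ?_⟩
    symm
    simp only [Finset.univ_eq_empty, Finset.biUnion_empty]
    rw [Finset.filter_eq_empty_iff]
    rintro ⟨a, b⟩ _ hab
    obtain ⟨L, hL⟩ := hcyc f h1 hc a b hab
    have hs := ht L hL
    have := hedge f L hL s (L.formPerm s) ((mem_cycleEdges_iff hL.2.1 _ _).2 ⟨hs, rfl⟩)
    have := (Finset.sum_eq_zero_iff.mp hK) (L.formPerm s) (Finset.mem_univ _)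
    omega
  | succ K ih =>
    intro f h1 hc ht hK
    obtain ⟨b, hb⟩ : ∃ b, f s b = 1 := by
      by_contra! hno
      have : ∑ y, f s y = 0 := by
        refine Finset.sum_eq_zero fun z _ => ?_
        have := h1 s z
        have := hno z
        omega
      omega
    obtain ⟨L, hL⟩ := hcyc f h1 hc s b hb
    have hs := ht L hL
    have hE := hedge f L hL
    let f' : V → V → ℕ := fun x y => if (x, y) ∈ cycleEdges L then 0 else f x y
    have hsplit : ∀ x y, f x y = f' x y + (if (x, y) ∈ cycleEdges L then 1 else 0) := by
      intro x y
      by_cases h : (x, y) ∈ cycleEdges L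
      · simp [f', h, hE x y h]
      · simp [f', h]
    have hout : ∀ x, ∑ y, f x y = ∑ y, f' x y + (if x ∈ L then 1 else 0) := by
      intro x
      rw [← sum_out_aux hL.2.1 x, ← Finset.sum_add_distrib]
      exact Finset.sum_congr rfl fun y _ => hsplit x y
    have hin : ∀ x, ∑ y, f y x = ∑ y, f' y x + (if x ∈ L then 1 else 0) := by
      intro x
      rw [← sum_in_aux hL.2.1 x, ← Finset.sum_add_distrib]
      exact Finset.sum_congr rfl fun y _ => hsplit y x
    have hsupp : ∀ x y, f' x y = 1 ↔ f x y = 1 ∧ (x, y) ∉ cycleEdges L := by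
      intro x y
      by_cases h : (x, y) ∈ cycleEdges L <;> simp [f', h]
    have hmono : ∀ M, IsSimpleCycle (fun x y => f' x y = 1) M →
        IsSimpleCycle (fun x y => f x y = 1) M :=
      fun M hM => ⟨hM.1, hM.2.1, fun i => ((hsupp _ _).1 (hM.2.2 i)).1⟩
    obtain ⟨Γ, g1, g2, g3, g4⟩ := ih f'
      (fun x y => by have := hsplit x y; have := h1 x y; omega)
      (fun x => by have := hout x; have := hin x; have := hc x; omega)
      (fun M hM => ht M (hmono M hM))
      (by have := hout s; rw [if_pos hs] at this; omega)
    have hd : ∀ i, Disjoint (cycleEdges L) (cycleEdges (Γ i)) := by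
      intro i
      rw [Finset.disjoint_left]
      rintro ⟨x, y⟩ h h'
      exact ((hsupp x y).1 (hedge f' _ (g1 i) x y h')).2 h
    refine ⟨Fin.cons L Γ, ?_, ?_, ?_, ?_⟩
    · intro i
      refine Fin.cases ?_ (fun i => ?_) i
      · simpa using hL
      · simpa using hmono _ (g1 i)
    · intro i
      refine Fin.cases ?_ (fun i => ?_) i
      · simpa using hs
      · simpa using g2 i
    · intro i j
      refine Fin.cases ?_ (fun i => ?_) i <;> refine Fin.cases ?_ (fun j => ?_) j
      · simp
      · intro _; simpa using hd j
      · intro _; simpa using (hd i).symm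
      · intro h
        simpa using g3 i j (fun e => h (by rw [e]))
    · ext ⟨x, y⟩
      have h4 : (∃ i, (x, y) ∈ cycleEdges (Γ i)) ↔ f' x y = 1 := by
        have := Finset.ext_iff.1 g4 (x, y)
        simpa using this
      simp only [Finset.mem_biUnion, Finset.mem_univ, true_and, Finset.mem_filter,
        Fin.exists_fin_succ, Fin.cons_zero, Fin.cons_succ]
      rw [h4, hsupp]
      have := hE x y
      tauto

theorem circulation_decomposes_into_K_cycles_through_s [Fintype V] [DecidableEq V]
    (c : V → V → ℝ) (cap : V → V → ℕ)
    (hloop : ∀ x, cap x x = 0)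
    (hanti : ∀ x y, x ≠ y → cap x y = 0 ∨ cap y x = 0)
    (hunit : ∀ x y, cap x y ≤ 1)
    (s : V) (f : V → V → ℕ) (hf : IsCirculation cap f)
    (hthrough : ∀ L : List V, IsSimpleCycle (fun x y => f x y = 1) L → s ∈ L) :
    ∃ Γ : Fin (∑ y, f s y) → List V,
      (∀ i, IsSimpleCycle (fun x y => f x y = 1) (Γ i)) ∧
      (∀ i, s ∈ Γ i) ∧
      (∀ i j, i ≠ j → Disjoint (cycleEdges (Γ i)) (cycleEdges (Γ j))) ∧
      Finset.univ.biUnion (fun i => cycleEdges (Γ i)) =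
        Finset.univ.filter (fun p : V × V => f p.1 p.2 = 1) := by
  exact decomp_aux s _ f (fun x y => (hf.1 x y).trans (hunit x y)) hf.2 hthrough rfl
end

section
/- Let f : V → V → ℕ satisfy f x y ≤ 1 for all x, y, f x x = 0 for all x, and ∑_y f x y = ∑_y f y x for every x (flow conservation). Then there exists a finite collection of pairwise edge-disjoint simple cycles of the support digraph of f (the directed graph with an edge x → y whenever f x y = 1) whose edge sets partition the support {(x, y) : f x y = 1}. -/
/-!
STATEMENT 2: A 0/1-valued function `f` with no self-loops satisfying flow
conservation decomposes: there is a finite collection of pairwise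
edge-disjoint simple cycles of the support digraph of `f` whose edge sets
partition the support of `f`.
-/

variable {V : Type*}

theorem aux_edges [DecidableEq V] (g : ℕ → V) (n : ℕ) (hg : g n = g 0) :
    cycleEdges ((List.range n).map g) =
      (Finset.range n).image (fun i => (g i, g (i + 1))) := by
  have key : ∀ i, i < n → g ((i + 1) % n) = g (i + 1) := by
    intro i hi
    rcases Nat.lt_or_ge (i + 1) n with h | h
    · rw [Nat.mod_eq_of_lt h]
    · have : i + 1 = n := by omega
      rw [this, Nat.mod_self, hg]
  ext p
  simp only [cycleEdges, Finset.mem_image, Finset.mem_univ, true_and, Finset.mem_range]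
  constructor
  · rintro ⟨⟨i, hi⟩, rfl⟩
    have hi' : i < n := by simpa using hi
    exact ⟨i, hi', by simp [key i hi']⟩
  · rintro ⟨i, hi, rfl⟩
    exact ⟨⟨i, by simpa using hi⟩, by simp [key i hi]⟩

theorem aux_cycle [DecidableEq V] (A : V → V → Prop) (g : ℕ → V) (n : ℕ) (hn : 0 < n)
    (hg : g n = g 0) (hinj : Set.InjOn g (Set.Iio n)) (hA : ∀ i, A (g i) (g (i + 1))) :
    IsSimpleCycle A ((List.range n).map g) := by
  refine ⟨by simp; omega, ?_, ?_⟩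
  · refine List.Nodup.map_on ?_ List.nodup_range
    intro x hx y hy h
    exact hinj (by simpa using hx) (by simpa using hy) h
  · rintro ⟨i, hi⟩
    have hi' : i < n := by simpa using hi
    have key : g ((i + 1) % n) = g (i + 1) := by
      rcases Nat.lt_or_ge (i + 1) n with h | h
      · rw [Nat.mod_eq_of_lt h]
      · have : i + 1 = n := by omega
        rw [this, Nat.mod_self, hg]
    simpa [key] using hA i

theorem aux_orbit [Finite V] (A : V → V → Prop) (a b : V) (hab : A a b)
    (h : ∀ x y, A x y → ∃ z, A y z) :
    ∃ (g : ℕ → V) (n : ℕ), 0 < n ∧ g n = g 0 ∧ Set.InjOn g (Set.Iio n) ∧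
      ∀ i, A (g i) (g (i + 1)) := by
  classical
  have hs : ∀ x, ∃ z, (∃ w, A w x) → A x z := by
    intro x
    by_cases hx : ∃ w, A w x
    · obtain ⟨w, hw⟩ := hx
      obtain ⟨z, hz⟩ := h w x hw
      exact ⟨z, fun _ => hz⟩
    · exact ⟨x, fun h' => absurd h' hx⟩
  choose s hs using hs
  have hit : ∀ k, ∃ w, A w (s^[k] b) := by
    intro k
    induction k with
    | zero => exact ⟨a, hab⟩
    | succ k ih =>
      rw [Function.iterate_succ_apply']
      exact ⟨_, hs _ ih⟩
  obtain ⟨k, l, hkl, he⟩ : ∃ k l, k < l ∧ s^[k] b = s^[l] b := by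
    obtain ⟨k, l, hne, he⟩ := Finite.exists_ne_map_eq_of_infinite (fun k : ℕ => s^[k] b)
    rcases Nat.lt_or_gt_of_ne hne with h1 | h1
    · exact ⟨k, l, h1, he⟩
    · exact ⟨l, k, h1, he.symm⟩
  have hper : Function.IsPeriodicPt s (l - k) (s^[k] b) := by
    unfold Function.IsPeriodicPt Function.IsFixedPt
    rw [← Function.iterate_add_apply, Nat.sub_add_cancel hkl.le, he]
  refine ⟨fun i => s^[i] (s^[k] b), Function.minimalPeriod s (s^[k] b),
    hper.minimalPeriod_pos (by omega), Function.iterate_minimalPeriod, ?_, ?_⟩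
  · exact Function.iterate_injOn_Iio_minimalPeriod
  · intro i
    simp only [Function.iterate_succ_apply']
    rw [← Function.iterate_add_apply]
    exact hs _ (hit _)

theorem aux_balance [Fintype V] [DecidableEq V] (g : ℕ → V) (n : ℕ) (hg : g n = g 0)
    (hinj : Set.InjOn g (Set.Iio n)) (x : V) :
    (∑ y, if (x, y) ∈ (Finset.range n).image (fun i => (g i, g (i + 1))) then 1 else 0) =
    (∑ y, if (y, x) ∈ (Finset.range n).image (fun i => (g i, g (i + 1))) then 1 else 0) := by
  set E := (Finset.range n).image (fun i => (g i, g (i + 1))) with hE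
  have hi : Set.InjOn (fun i => (g i, g (i + 1))) (Finset.range n : Set ℕ) := by
    intro i hi j hj h
    exact hinj (by simpa using hi) (by simpa using hj) (Prod.ext_iff.1 h).1
  have h1 : (∑ y, if (x, y) ∈ E then 1 else 0) = ∑ e ∈ E, if e.1 = x then 1 else 0 := by
    rw [← Finset.card_filter, ← Finset.card_filter]
    refine Finset.card_bij (fun y _ => (x, y)) (by simp) (by simp) ?_
    rintro ⟨u, v⟩ h
    simp only [Finset.mem_filter] at h
    obtain ⟨h, rfl⟩ := h
    exact ⟨v, by simpa using h, rfl⟩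
  have h2 : (∑ y, if (y, x) ∈ E then 1 else 0) = ∑ e ∈ E, if e.2 = x then 1 else 0 := by
    rw [← Finset.card_filter, ← Finset.card_filter]
    refine Finset.card_bij (fun y _ => (y, x)) (by simp) (by simp) ?_
    rintro ⟨u, v⟩ h
    simp only [Finset.mem_filter] at h
    obtain ⟨h, rfl⟩ := h
    exact ⟨u, by simpa using h, rfl⟩
  rw [h1, h2, hE, Finset.sum_image hi, Finset.sum_image hi]
  have e1 := Finset.sum_range_succ (fun i => if g i = x then 1 else 0) n
  have e2 := Finset.sum_range_succ' (fun i => if g i = x then 1 else 0) n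
  simp only [hg] at e1
  simp only
  omega

theorem aux_main [Fintype V] [DecidableEq V] (N : ℕ) : ∀ (f : V → V → ℕ)
    (_ : ∀ x y, f x y ≤ 1)
    (_ : ∀ x, ∑ y, f x y = ∑ y, f y x)
    (_ : (Finset.univ.filter (fun p : V × V => f p.1 p.2 = 1)).card ≤ N),
    ∃ (m : ℕ) (Γ : Fin m → List V),
      (∀ i, IsSimpleCycle (fun x y => f x y = 1) (Γ i)) ∧
      (∀ i j, i ≠ j → Disjoint (cycleEdges (Γ i)) (cycleEdges (Γ j))) ∧
      Finset.univ.biUnion (fun i => cycleEdges (Γ i)) =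
        Finset.univ.filter (fun p : V × V => f p.1 p.2 = 1) := by
  induction N with
  | zero =>
    intro f _ _ hN
    refine ⟨0, Fin.elim0, fun i => i.elim0, fun i => i.elim0, ?_⟩
    rw [Finset.card_eq_zero.1 (Nat.le_zero.1 hN)]
    simp
  | succ N ih =>
    intro f hunit hcons hN
    by_cases hne : ∃ a b, f a b = 1
    swap
    · refine ⟨0, Fin.elim0, fun i => i.elim0, fun i => i.elim0, ?_⟩
      push Not at hne
      symm
      ext p
      simp [hne]
    obtain ⟨a, b, hab⟩ := hne
    obtain ⟨g, n, hn, hg, hinj, hA⟩ := aux_orbit (fun x y => f x y = 1) a b hab (by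
      intro x y hxy
      by_contra hcon
      push Not at hcon
      have h0 : ∑ z, f y z = 0 := by
        refine Finset.sum_eq_zero fun z _ => ?_
        have := hunit y z
        have := hcon z
        omega
      have h1 : f x y ≤ ∑ z, f z y :=
        Finset.single_le_sum (f := fun z => f z y) (fun _ _ => Nat.zero_le _) (Finset.mem_univ x)
      have := hcons y
      omega)
    have hcyc := aux_cycle (fun x y => f x y = 1) g n hn hg hinj hA
    have hE := aux_edges g n hg
    have hbal := aux_balance g n hg hinj
    rw [← hE] at hbal
    set L := (List.range n).map g
    have hEf : ∀ p ∈ cycleEdges L, f p.1 p.2 = 1 := by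
      intro p hp
      rw [hE] at hp
      obtain ⟨i, _, rfl⟩ := Finset.mem_image.1 hp
      exact hA i
    let f' : V → V → ℕ := fun x y => if (x, y) ∈ cycleEdges L then 0 else f x y
    have hsplit : ∀ x y, f x y = f' x y + if (x, y) ∈ cycleEdges L then 1 else 0 := by
      intro x y
      simp only [f']
      split_ifs with h
      · simpa using hEf _ h
      · simp
    have hf'1 : ∀ x y, f' x y = 1 ↔ f x y = 1 ∧ (x, y) ∉ cycleEdges L := by
      intro x y
      simp only [f']
      split_ifs with h <;> simp [h]
    obtain ⟨m, Γ, c1, c2, c3⟩ := ih f'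
      (by
        intro x y
        have := hunit x y
        have := hsplit x y
        omega)
      (by
        intro x
        have h := hcons x
        simp only [hsplit, Finset.sum_add_distrib] at h
        have := hbal x
        omega)
      (by
        refine Nat.lt_succ_iff.1 (lt_of_lt_of_le (Finset.card_lt_card ?_) hN)
        refine Finset.ssubset_iff_subset_ne.2 ⟨?_, ?_⟩
        · intro p
          simp only [Finset.mem_filter, Finset.mem_univ, true_and, hf'1]
          exact fun h => h.1
        · intro heq
          have h1 : (g 0, g 1) ∈ cycleEdges L := by
            rw [hE]
            exact Finset.mem_image.2 ⟨0, by simpa using hn, rfl⟩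
          have h2 : (g 0, g 1) ∈ Finset.univ.filter (fun p : V × V => f p.1 p.2 = 1) := by
            simpa using hA 0
          rw [← heq] at h2
          simp only [Finset.mem_filter, Finset.mem_univ, true_and, hf'1] at h2
          exact h2.2 h1)
    have hdis : ∀ i, Disjoint (cycleEdges L) (cycleEdges (Γ i)) := by
      intro i
      rw [Finset.disjoint_left]
      intro p hp hq
      have : p ∈ Finset.univ.biUnion (fun i => cycleEdges (Γ i)) :=
        Finset.mem_biUnion.2 ⟨i, Finset.mem_univ _, hq⟩
      rw [c3] at this
      simp only [Finset.mem_filter, Finset.mem_univ, true_and, hf'1] at this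
      exact this.2 hp
    refine ⟨m + 1, Fin.cons L Γ, ?_, ?_, ?_⟩
    · intro i
      refine Fin.cases ?_ (fun i => ?_) i
      · simpa using hcyc
      · simp only [Fin.cons_succ]
        exact ⟨(c1 i).1, (c1 i).2.1, fun j => ((hf'1 _ _).1 ((c1 i).2.2 j)).1⟩
    · intro i j
      refine Fin.cases ?_ (fun i => ?_) i <;> refine Fin.cases ?_ (fun j => ?_) j
      · simp
      · intro _
        simpa using hdis j
      · intro _
        simpa using (hdis i).symm
      · intro hij
        simpa using c2 i j (fun h => hij (by rw [h]))
    · ext p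
      have h3 := Finset.ext_iff.1 c3 p
      simp only [Finset.mem_biUnion, Finset.mem_univ, true_and, Finset.mem_filter, hf'1] at h3
      simp only [Finset.mem_biUnion, Finset.mem_univ, true_and, Finset.mem_filter,
        Fin.exists_fin_succ, Fin.cons_zero, Fin.cons_succ, h3]
      have := hEf p
      tauto

theorem support_partitions_into_cycles [Fintype V] [DecidableEq V]
    (f : V → V → ℕ)
    (hunit : ∀ x y, f x y ≤ 1)
    (hloop : ∀ x, f x x = 0)
    (hcons : ∀ x, ∑ y, f x y = ∑ y, f y x) :
    ∃ (m : ℕ) (Γ : Fin m → List V),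
      (∀ i, IsSimpleCycle (fun x y => f x y = 1) (Γ i)) ∧
      (∀ i j, i ≠ j → Disjoint (cycleEdges (Γ i)) (cycleEdges (Γ j))) ∧
      Finset.univ.biUnion (fun i => cycleEdges (Γ i)) =
        Finset.univ.filter (fun p : V × V => f p.1 p.2 = 1) := by
  exact aux_main _ f hunit hcons le_rfl
end

section
/- Let s, u, v ∈ V be pairwise distinct. Assume unit capacities (cap x y ≤ 1 for all x, y) and the following structure: cap u v = 1 and cap u y = 0 for all y ≠ v; cap v s = 1 and cap v y = 0 for all y ≠ s; cap y v = 0 for all y ≠ u. Let f be a feasible circulation with f x y = 0 whenever x ∈ {u, v} or y ∈ {u, v}, and assume the residual graph of f contains no negative cycle that visits neither u nor v. Let Γ be a simple cycle of the residual graph of f whose cost is minimal among the costs of all simple cycles of the residual graph of f, and suppose cost(Γ) < 0. Then the augmentation f′ of f along Γ is a feasible circulation of minimum cost among all feasible circulations. -/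
/-!
STATEMENT 3: with the special structure around the pairwise distinct vertices
`s, u, v` (unit capacities, `u`'s only out-edge goes to `v`, `v`'s only
out-edge goes to `s`, `v`'s only in-edge comes from `u`), if `f` is a feasible
circulation carrying no flow on edges touching `u` or `v`, whose residual
graph has no negative cycle avoiding both `u` and `v`, and `Γ` is a minimum
cost simple cycle of the residual graph with negative cost, then augmenting
`f` along `Γ` yields a minimum-cost feasible circulation.
-/

variable {V : Type*}

/-- The augmentation of `f` along a simple cycle `L` of the residual graph:
increase by one unit along each forward residual edge traversed by `L`,
decrease by one unit along the original edge of each backward residual edge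
traversed by `L`. -/
def augment [DecidableEq V] (cap f : V → V → ℕ) (L : List V) (x y : V) : ℕ :=
  f x y + (if (x, y) ∈ cycleEdges L ∧ f x y < cap x y then 1 else 0)
    - (if (y, x) ∈ cycleEdges L ∧ 0 < f x y then 1 else 0)

def cycNext (L : List V) (i : Fin L.length) : Fin L.length :=
  ⟨(i + 1) % L.length, Nat.mod_lt _ i.pos⟩

theorem cycNext_bij (L : List V) : Function.Bijective (cycNext L) := by
  rw [← Finite.injective_iff_bijective]
  intro i j h
  have h1 : ((i : ℕ) + 1) % L.length = ((j : ℕ) + 1) % L.length := congrArg Fin.val h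
  have hi := i.isLt
  have hj := j.isLt
  apply Fin.ext
  rcases Nat.lt_or_ge ((i : ℕ) + 1) L.length with h2 | h2 <;>
  rcases Nat.lt_or_ge ((j : ℕ) + 1) L.length with h3 | h3
  · rw [Nat.mod_eq_of_lt h2, Nat.mod_eq_of_lt h3] at h1; omega
  · have : (j : ℕ) + 1 = L.length := by omega
    rw [Nat.mod_eq_of_lt h2, this, Nat.mod_self] at h1; omega
  · have : (i : ℕ) + 1 = L.length := by omega
    rw [Nat.mod_eq_of_lt h3, this, Nat.mod_self] at h1; omega
  · omega

theorem sum_cycleEdges [DecidableEq V] {R : Type*} [AddCommMonoid R] (L : List V)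
    (hL : L.Nodup) (F : V × V → R) :
    ∑ e ∈ cycleEdges L, F e = ∑ i : Fin L.length, F (L.get i, L.get (cycNext L i)) := by
  unfold cycleEdges
  rw [Finset.sum_image]
  · rfl
  · intro i _ j _ h
    exact List.nodup_iff_injective_get.1 hL (Prod.ext_iff.1 h).1

def cycInd [DecidableEq V] (L : List V) (x y : V) : ℕ :=
  if (x, y) ∈ cycleEdges L then 1 else 0

theorem cycInd_cons [Fintype V] [DecidableEq V] (L : List V) (hL : L.Nodup) (x : V) :
    ∑ y, cycInd L x y = ∑ y, cycInd L y x := by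
  have h1 : ∑ y, cycInd L x y = ∑ e ∈ cycleEdges L, if e.1 = x then 1 else 0 := by
    have : ∑ e ∈ cycleEdges L, (if e.1 = x then 1 else 0) =
        ∑ e : V × V, if e ∈ cycleEdges L then (if e.1 = x then 1 else 0) else 0 := by
      rw [Finset.sum_ite_mem, Finset.univ_inter]
    rw [this, Fintype.sum_prod_type]
    symm
    rw [Finset.sum_eq_single x]
    · simp [cycInd]
    · intro b _ hb
      simp [hb]
    · simp
  have h2 : ∑ y, cycInd L y x = ∑ e ∈ cycleEdges L, if e.2 = x then 1 else 0 := by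
    have : ∑ e ∈ cycleEdges L, (if e.2 = x then 1 else 0) =
        ∑ e : V × V, if e ∈ cycleEdges L then (if e.2 = x then 1 else 0) else 0 := by
      rw [Finset.sum_ite_mem, Finset.univ_inter]
    rw [this, Fintype.sum_prod_type_right]
    symm
    rw [Finset.sum_eq_single x]
    · simp [cycInd]
    · intro b _ hb
      simp [hb]
    · simp
  rw [h1, h2, sum_cycleEdges L hL, sum_cycleEdges L hL]
  exact ((cycNext_bij L).sum_comp (fun i => if L.get i = x then 1 else 0)).symm

theorem cycInd_cost [Fintype V] [DecidableEq V] (L : List V) (hL : L.Nodup)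
    (c : V → V → ℝ) :
    ∑ x, ∑ y, c x y * (cycInd L x y : ℝ) = cycleCost c L := by
  have : cycleCost c L = ∑ e ∈ cycleEdges L, c e.1 e.2 := by
    rw [sum_cycleEdges L hL]; rfl
  rw [this, ← Fintype.sum_prod_type (f := fun e : V × V => c e.1 e.2 * (cycInd L e.1 e.2 : ℝ))]
  simp [cycInd, Finset.sum_ite_mem]

theorem mem_cycleEdges_adj [DecidableEq V] {A : V → V → Prop} {L : List V}
    (hL : IsSimpleCycle A L) {x y : V} (h : (x, y) ∈ cycleEdges L) : A x y := by
  unfold cycleEdges at h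
  simp only [Finset.mem_image, Finset.mem_univ, true_and] at h
  obtain ⟨i, hi⟩ := h
  have := hL.2.2 i
  rw [Prod.mk.injEq] at hi
  rw [← hi.1, ← hi.2]; exact this

theorem mem_of_mem_cycleEdges [DecidableEq V] {L : List V}
    {x y : V} (h : (x, y) ∈ cycleEdges L) : x ∈ L ∧ y ∈ L := by
  unfold cycleEdges at h
  simp only [Finset.mem_image, Finset.mem_univ, true_and] at h
  obtain ⟨i, hi⟩ := h
  rw [Prod.mk.injEq] at hi
  rw [← hi.1, ← hi.2]
  exact ⟨List.get_mem _ _, List.get_mem _ _⟩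

theorem exists_succ [DecidableEq V] {L : List V}
    {x : V} (h : x ∈ L) : ∃ y, (x, y) ∈ cycleEdges L := by
  obtain ⟨i, hi⟩ := List.mem_iff_get.1 h
  refine ⟨L.get (cycNext L i), ?_⟩
  unfold cycleEdges
  simp only [Finset.mem_image, Finset.mem_univ, true_and]
  exact ⟨i, by rw [← hi]; rfl⟩

theorem exists_cycle_s3 [Fintype V] (A : V → V → Prop)
    (hA : ∀ x y, A x y → ∃ z, A y z) (x₀ y₀ : V) (h0 : A x₀ y₀) :
    ∃ L, IsSimpleCycle A L := by
  classical
  let N : V → V := fun x => if h : ∃ z, A x z then h.choose else x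
  have hN : ∀ x, (∃ z, A x z) → A x (N x) := by
    intro x h
    simp only [N, dif_pos h]
    exact h.choose_spec
  have hit : ∀ n, ∃ z, A (N^[n] x₀) z := by
    intro n
    induction n with
    | zero => exact ⟨y₀, h0⟩
    | succ n ih =>
      rw [Function.iterate_succ_apply']
      exact hA _ _ (hN _ ih)
  obtain ⟨a, b, hab, hfe⟩ := Finite.exists_ne_map_eq_of_infinite (fun n : ℕ => N^[n] x₀)
  wlog hlt : a < b generalizing a b
  · exact this b a hab.symm hfe.symm (by omega)
  set x := N^[a] x₀ with hx
  have hper : x ∈ Function.periodicPts N := by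
    refine ⟨b - a, by omega, ?_⟩
    change N^[b - a] x = x
    rw [hx, ← Function.iterate_add_apply, Nat.sub_add_cancel hlt.le]
    exact hfe.symm
  have hitx : ∀ n, ∃ z, A (N^[n] x) z := by
    intro n
    rw [hx, ← Function.iterate_add_apply]
    exact hit _
  have hp : 0 < Function.minimalPeriod N x := Function.minimalPeriod_pos_of_mem_periodicPts hper
  refine ⟨(List.range (Function.minimalPeriod N x)).map (fun n => N^[n] x), ?_, ?_, ?_⟩
  · intro h
    have := congrArg List.length h
    simp at this
    omega
  · apply List.Nodup.map_on _ List.nodup_range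
    intro i hi j hj h
    rw [List.mem_range] at hi hj
    exact Function.iterate_injOn_Iio_minimalPeriod hi hj h
  · intro i
    simp only [List.get_eq_getElem, List.getElem_map, List.getElem_range, List.length_map,
      List.length_range, Function.iterate_mod_minimalPeriod_eq]
    rw [Function.iterate_succ_apply']
    exact hN _ (hitx _)

theorem cost_lower [Fintype V] [DecidableEq V] (A : V → V → Prop) (c : V → V → ℝ) (v s : V)
    (K : ℝ) (hout : ∀ y, A v y → y = s)
    (h1 : ∀ L, IsSimpleCycle A L → K ≤ cycleCost c L)
    (h2 : ∀ L, IsSimpleCycle A L → v ∉ L → 0 ≤ cycleCost c L) :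
    ∀ (n : ℕ) (h : V → V → ℕ), ∑ x, ∑ y, h x y = n → (∀ x y, 0 < h x y → A x y) →
      (∀ x, ∑ y, h x y = ∑ y, h y x) →
      (h v s : ℝ) * K ≤ ∑ x, ∑ y, c x y * (h x y : ℝ) := by
  intro n
  induction n using Nat.strong_induction_on with
  | _ n ih =>
  intro h hn hsupp hcons
  by_cases hz : ∀ x y, h x y = 0
  · simp [hz]
  push Not at hz
  obtain ⟨x₀, y₀, h0⟩ := hz
  obtain ⟨L, hL⟩ := exists_cycle_s3 (fun x y => 0 < h x y) (by
    intro x y hxy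
    by_contra hcon
    push Not at hcon
    have e := hcons y
    rw [Finset.sum_eq_zero (fun z _ => Nat.le_zero.1 (hcon z))] at e
    have := (Finset.sum_eq_zero_iff.1 e.symm) x (Finset.mem_univ _)
    omega) x₀ y₀ (Nat.pos_of_ne_zero h0)
  have hLA : IsSimpleCycle A L := ⟨hL.1, hL.2.1, fun i => hsupp _ _ (hL.2.2 i)⟩
  have hle : ∀ x y, cycInd L x y ≤ h x y := by
    intro x y
    unfold cycInd
    split_ifs with he
    · exact mem_cycleEdges_adj hL he
    · exact Nat.zero_le _
  obtain ⟨k, hk⟩ : ∃ k : V → V → ℕ, ∀ x y, h x y = k x y + cycInd L x y :=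
    ⟨fun x y => h x y - cycInd L x y, fun x y => (Nat.sub_add_cancel (hle x y)).symm⟩
  have hkcons : ∀ x, ∑ y, k x y = ∑ y, k y x := by
    intro x
    have e := hcons x
    simp only [hk, Finset.sum_add_distrib] at e
    have := cycInd_cons L hL.2.1 x
    omega
  have hpos : 0 < ∑ x, ∑ y, cycInd L x y := by
    obtain ⟨a, ha⟩ := List.exists_mem_of_ne_nil L hL.1
    obtain ⟨b, hb⟩ := exists_succ ha
    apply Finset.sum_pos' (fun _ _ => Nat.zero_le _)
    refine ⟨a, Finset.mem_univ _, ?_⟩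
    apply Finset.sum_pos' (fun _ _ => Nat.zero_le _)
    exact ⟨b, Finset.mem_univ _, by simp [cycInd, hb]⟩
  have hlt : ∑ x, ∑ y, k x y < n := by
    rw [← hn]
    simp only [hk, Finset.sum_add_distrib]
    omega
  have IH := ih _ hlt k rfl (fun x y hxy => hsupp x y (by rw [hk]; omega)) hkcons
  have hc : ∑ x, ∑ y, c x y * (h x y : ℝ) =
      ∑ x, ∑ y, c x y * (k x y : ℝ) + cycleCost c L := by
    rw [← cycInd_cost L hL.2.1 c]
    simp only [hk, ← Finset.sum_add_distrib]
    push_cast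
    simp only [mul_add]
  rw [hc, hk v s]
  by_cases hv : v ∈ L
  · obtain ⟨y, hy⟩ := exists_succ hv
    have := hout y (mem_cycleEdges_adj hLA hy)
    subst this
    have e : cycInd L v y = 1 := by simp [cycInd, hy]
    rw [e]
    have := h1 L hLA
    push_cast
    linarith
  · have e : cycInd L v s = 0 := by
      unfold cycInd
      rw [if_neg]
      intro he
      exact hv (mem_of_mem_cycleEdges he).1
    rw [e]
    have := h2 L hLA hv
    push_cast
    linarith

/-- The relation "g is f plus the residual flow h". -/
theorem res_transfer [Fintype V] (c : V → V → ℝ) (cap f g h : V → V → ℕ)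
    (hex : ∀ x y, 0 < cap x y → cap y x = 0)
    (hfc : ∀ x y, f x y ≤ cap x y)
    (hs : ∀ x y, 0 < h x y → ResAdj cap f x y)
    (hg : ∀ x y, (g x y : ℤ) = f x y + (if f x y < cap x y then (h x y : ℤ) else 0)
      - (if 0 < f x y then (h y x : ℤ) else 0)) :
    (∀ x, (∑ y, (g x y : ℤ)) - ∑ y, (g y x : ℤ) =
      (∑ y, (f x y : ℤ)) - ∑ y, (f y x : ℤ) + (∑ y, (h x y : ℤ)) - ∑ y, (h y x : ℤ)) ∧
    flowCost c g = flowCost c f + ∑ x, ∑ y, resCost c f x y * (h x y : ℝ) := by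
  constructor
  · intro x
    simp only [← Finset.sum_sub_distrib, ← Finset.sum_add_distrib]
    apply Finset.sum_congr rfl
    intro y _
    rw [hg x y, hg y x]
    have a1 := hs x y
    have a2 := hs y x
    have b1 := hex x y
    have b2 := hex y x
    have c1 := hfc x y
    have c2 := hfc y x
    unfold ResAdj at a1 a2
    split_ifs <;> omega
  · have hgR : ∀ x y, (g x y : ℝ) = f x y + (if f x y < cap x y then (h x y : ℝ) else 0)
      - (if 0 < f x y then (h y x : ℝ) else 0) := by
      intro x y
      exact_mod_cast hg x y
    have e1 : flowCost c g = flowCost c f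
        + ∑ x, ∑ y, c x y * (if f x y < cap x y then (h x y : ℝ) else 0)
        - ∑ x, ∑ y, c x y * (if 0 < f x y then (h y x : ℝ) else 0) := by
      unfold flowCost
      simp only [← Finset.sum_sub_distrib, ← Finset.sum_add_distrib]
      refine Finset.sum_congr rfl fun x _ => Finset.sum_congr rfl fun y _ => ?_
      rw [hgR]; ring
    rw [e1, Finset.sum_comm (f := fun x y => c x y * (if 0 < f x y then (h y x : ℝ) else 0)),
      add_sub_assoc]
    congr 1
    simp only [← Finset.sum_sub_distrib]
    refine Finset.sum_congr rfl fun x _ => Finset.sum_congr rfl fun y _ => ?_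
    have a1 := hs x y
    have b1 := hex x y
    have b2 := hex y x
    have c1 := hfc x y
    have c2 := hfc y x
    unfold ResAdj at a1
    unfold resCost
    by_cases p : 0 < f y x
    · have : ¬ f x y < cap x y := by omega
      simp [p, this]
    · by_cases q : f x y < cap x y
      · simp [p, q]
      · have : h x y = 0 := by omega
        simp [this]

theorem augment_min_cycle_is_optimal [Fintype V] [DecidableEq V]
    (c : V → V → ℝ) (cap : V → V → ℕ)
    (hloop : ∀ x, cap x x = 0)
    (hanti : ∀ x y, x ≠ y → cap x y = 0 ∨ cap y x = 0)
    (hunit : ∀ x y, cap x y ≤ 1)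
    (s u v : V) (hsu : s ≠ u) (hsv : s ≠ v) (huv : u ≠ v)
    (hcap_uv : cap u v = 1) (hcap_u : ∀ y, y ≠ v → cap u y = 0)
    (hcap_vs : cap v s = 1) (hcap_v : ∀ y, y ≠ s → cap v y = 0)
    (hcap_inv : ∀ y, y ≠ u → cap y v = 0)
    (f : V → V → ℕ) (hf : IsCirculation cap f)
    (hf0 : ∀ x y, (x = u ∨ x = v ∨ y = u ∨ y = v) → f x y = 0)
    (hnoneg : ¬ ∃ L : List V, IsSimpleCycle (ResAdj cap f) L ∧ u ∉ L ∧ v ∉ L ∧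
      cycleCost (resCost c f) L < 0)
    (Γ : List V) (hΓ : IsSimpleCycle (ResAdj cap f) Γ)
    (hmin : ∀ L : List V, IsSimpleCycle (ResAdj cap f) L →
      cycleCost (resCost c f) Γ ≤ cycleCost (resCost c f) L)
    (hneg : cycleCost (resCost c f) Γ < 0) :
    IsCirculation cap (augment cap f Γ) ∧
      ∀ g, IsCirculation cap g → flowCost c (augment cap f Γ) ≤ flowCost c g := by
  have hex : ∀ x y, 0 < cap x y → cap y x = 0 := by
    intro x y h
    by_cases e : x = y
    · subst e; exact hloop x
    · rcases hanti x y e with h' | h'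
      · omega
      · exact h'
  have hind : ∀ x y, 0 < cycInd Γ x y → ResAdj cap f x y := by
    intro x y h
    unfold cycInd at h
    split_ifs at h with he
    · exact mem_cycleEdges_adj hΓ he
    · omega
  have haug : ∀ x y, (augment cap f Γ x y : ℤ) = f x y +
      (if f x y < cap x y then (cycInd Γ x y : ℤ) else 0)
      - (if 0 < f x y then (cycInd Γ y x : ℤ) else 0) := by
    intro x y
    unfold augment cycInd
    by_cases a : (x, y) ∈ cycleEdges Γ <;> by_cases b : (y, x) ∈ cycleEdges Γ <;>
      simp only [a, b, true_and, false_and, if_true, if_false] <;> split_ifs <;> omega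
  obtain ⟨t1, t2⟩ := res_transfer c cap f (augment cap f Γ) (cycInd Γ) hex hf.1 hind haug
  rw [cycInd_cost Γ hΓ.2.1] at t2
  refine ⟨⟨?_, ?_⟩, ?_⟩
  · intro x y
    unfold augment
    have := hf.1 x y
    split_ifs <;> omega
  · intro x
    have e := t1 x
    have e1 : (∑ y, (f x y : ℤ)) = ∑ y, (f y x : ℤ) := by exact_mod_cast hf.2 x
    have e2 : (∑ y, (cycInd Γ x y : ℤ)) = ∑ y, (cycInd Γ y x : ℤ) := by
      exact_mod_cast cycInd_cons Γ hΓ.2.1 x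
    have e3 : (∑ y, (augment cap f Γ x y : ℤ)) = ∑ y, (augment cap f Γ y x : ℤ) := by linarith
    exact_mod_cast e3
  · intro g hg
    obtain ⟨h, hh⟩ : ∃ h : V → V → ℕ, ∀ x y, h x y = (g x y - f x y) + (f y x - g y x) :=
      ⟨_, fun _ _ => rfl⟩
    have hs : ∀ x y, 0 < h x y → ResAdj cap f x y := by
      intro x y h0
      rw [hh] at h0
      have := hg.1 x y
      unfold ResAdj
      omega
    have hgh : ∀ x y, (g x y : ℤ) = f x y + (if f x y < cap x y then (h x y : ℤ) else 0)
      - (if 0 < f x y then (h y x : ℤ) else 0) := by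
      intro x y
      have a1 := hg.1 x y
      have a2 := hg.1 y x
      have a3 := hf.1 x y
      have a4 := hf.1 y x
      have b1 := hex x y
      have b2 := hex y x
      rw [hh x y, hh y x]
      split_ifs <;> omega
    obtain ⟨r1, r2⟩ := res_transfer c cap f g h hex hf.1 hs hgh
    have hcons : ∀ x, ∑ y, h x y = ∑ y, h y x := by
      intro x
      have e := r1 x
      have e1 : (∑ y, (f x y : ℤ)) = ∑ y, (f y x : ℤ) := by exact_mod_cast hf.2 x
      have e2 : (∑ y, (g x y : ℤ)) = ∑ y, (g y x : ℤ) := by exact_mod_cast hg.2 x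
      have e3 : (∑ y, (h x y : ℤ)) = ∑ y, (h y x : ℤ) := by linarith
      exact_mod_cast e3
    have key := cost_lower (ResAdj cap f) (resCost c f) v s (cycleCost (resCost c f) Γ)
      (by
        intro y hy
        unfold ResAdj at hy
        rw [hf0 y v (by simp)] at hy
        by_contra hne
        have := hcap_v y hne
        omega)
      hmin
      (by
        intro L hL hvL
        by_contra hlt
        push Not at hlt
        refine hnoneg ⟨L, hL, ?_, hvL, hlt⟩
        intro huL
        obtain ⟨y, hy⟩ := exists_succ huL
        have hA := mem_cycleEdges_adj hL hy
        unfold ResAdj at hA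
        rw [hf0 y u (by simp)] at hA
        have hyv : y = v := by
          by_contra hne
          have := hcap_u y hne
          omega
        subst hyv
        exact hvL (mem_of_mem_cycleEdges hy).2)
      _ h rfl hs hcons
    have hvs : h v s ≤ 1 := by
      rw [hh]
      have := hg.1 v s
      have := hf0 s v (by simp)
      omega
    have hvs' : (h v s : ℝ) ≤ 1 := by exact_mod_cast hvs
    rw [t2, r2]
    nlinarith
end

section
/- Let (A, c) be a directed graph on V and let Γ be a simple cycle of (A, c) such that for every edge (x, y) of Γ, (y, x) is not an edge of A. Let (A′, c′) be obtained from (A, c) by removing every edge (x, y) of Γ and adding the reversed edge (y, x) with cost −(c x y), keeping all other edges and costs unchanged. Suppose u, v, s ∈ V are such that v is the only out-neighbor of u in A, s is the only out-neighbor of v in A, and Γ contains the edges (u, v) and (v, s). Then every simple cycle of (A′, c′) that uses none of the reversed edges of Γ visits neither u nor v, is a simple cycle of (A, c), and has the same cost in (A, c) as in (A′, c′). -/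
/-!
STATEMENT 5: let `Γ` be a simple cycle of `(A, c)` none of whose edges has an
antiparallel companion in `A`, and let `(A', c')` be obtained by removing the
edges of `Γ` and adding their reversals with negated cost. If `v` is the only
out-neighbor of `u` in `A`, `s` the only out-neighbor of `v` in `A`, and `Γ`
contains the edges `(u, v)` and `(v, s)`, then every simple cycle of
`(A', c')` using none of the reversed edges of `Γ` visits neither `u` nor
`v`, is a simple cycle of `(A, c)`, and has the same cost in both graphs.
-/

variable {V : Type*}

theorem cycle_avoiding_reversed_edges [Fintype V] [DecidableEq V]
    (A : V → V → Prop) (c : V → V → ℝ) (s u v : V)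
    (Γ : List V) (hΓ : IsSimpleCycle A Γ)
    (hnoanti : ∀ x y, (x, y) ∈ cycleEdges Γ → ¬ A y x)
    (A' : V → V → Prop) (c' : V → V → ℝ)
    (hA' : ∀ x y, A' x y ↔ ((A x y ∧ (x, y) ∉ cycleEdges Γ) ∨ (y, x) ∈ cycleEdges Γ))
    (hc'rev : ∀ x y, (y, x) ∈ cycleEdges Γ → c' x y = -(c y x))
    (hc'keep : ∀ x y, (y, x) ∉ cycleEdges Γ → c' x y = c x y)
    (hAuv : A u v) (huOut : ∀ y, A u y → y = v)
    (hAvs : A v s) (hvOut : ∀ y, A v y → y = s)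
    (huvΓ : (u, v) ∈ cycleEdges Γ) (hvsΓ : (v, s) ∈ cycleEdges Γ)
    (L : List V) (hL : IsSimpleCycle A' L)
    (hLnorev : ∀ x y, (x, y) ∈ cycleEdges L → (y, x) ∉ cycleEdges Γ) :
    u ∉ L ∧ v ∉ L ∧ IsSimpleCycle A L ∧ cycleCost c L = cycleCost c' L := by
  have hedge : ∀ i : Fin L.length,
      (L.get i, L.get ⟨(i + 1) % L.length, Nat.mod_lt _ i.pos⟩) ∈ cycleEdges L := fun i =>
    Finset.mem_image.2 ⟨i, Finset.mem_univ _, rfl⟩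
  have key : ∀ i : Fin L.length,
      A (L.get i) (L.get ⟨(i + 1) % L.length, Nat.mod_lt _ i.pos⟩) ∧
      (L.get i, L.get ⟨(i + 1) % L.length, Nat.mod_lt _ i.pos⟩) ∉ cycleEdges Γ := fun i =>
    ((hA' _ _).1 (hL.2.2 i)).resolve_right (hLnorev _ _ (hedge i))
  have avoid : ∀ a b : V, (∀ y, A a y → y = b) → (a, b) ∈ cycleEdges Γ → a ∉ L := by
    intro a b hout hmem ha
    obtain ⟨i, hi⟩ := List.get_of_mem ha
    obtain ⟨h1, h2⟩ := key i
    rw [hi] at h1 h2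
    rw [hout _ h1] at h2
    exact h2 hmem
  refine ⟨avoid u v huOut huvΓ, avoid v s hvOut hvsΓ,
    ⟨hL.1, hL.2.1, fun i => (key i).1⟩, ?_⟩
  unfold cycleCost
  exact Finset.sum_congr rfl fun i _ => (hc'keep _ _ (hLnorev _ _ (hedge i))).symm
end

section
/- Let (A, c) be a directed graph on V and let s, u, v ∈ V be pairwise distinct. Suppose: the subgraph of (A, c) induced on V \ {u, v} contains no negative cycle; v is the only out-neighbor of u; s is the only out-neighbor of v; and u is the only in-neighbor of v. Then every negative cycle of (A, c) contains the consecutive edges (u, v) and (v, s), i.e., it visits u, its successor of u is v, and its successor of v is s. -/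
/-!
STATEMENT 6: if the subgraph of `(A, c)` induced on `V \ {u, v}` has no
negative cycle, `v` is the only out-neighbor of `u`, `s` is the only
out-neighbor of `v`, and `u` is the only in-neighbor of `v`, then every
negative cycle of `(A, c)` contains the consecutive edges `(u, v)` and
`(v, s)`.
-/

variable {V : Type*}

theorem negative_cycle_must_use_new_edges [Fintype V] [DecidableEq V]
    (A : V → V → Prop) (c : V → V → ℝ) (s u v : V)
    (hsu : s ≠ u) (hsv : s ≠ v) (huv : u ≠ v)
    (hind : ¬ ∃ L : List V,
      IsSimpleCycle (fun x y => A x y ∧ x ≠ u ∧ x ≠ v ∧ y ≠ u ∧ y ≠ v) L ∧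
        cycleCost c L < 0)
    (hAuv : A u v) (huOut : ∀ y, A u y → y = v)
    (hAvs : A v s) (hvOut : ∀ y, A v y → y = s)
    (hvIn : ∀ y, A y v → y = u)
    (L : List V) (hL : IsSimpleCycle A L) (hneg : cycleCost c L < 0) :
    u ∈ L ∧ (u, v) ∈ cycleEdges L ∧ (v, s) ∈ cycleEdges L := by
  have hcyc := hL.2.2
  by_cases hu : u ∈ L
  · refine ⟨hu, ?_⟩
    obtain ⟨i, hi⟩ := List.get_of_mem hu
    have h1 := hcyc i
    rw [hi] at h1
    have h2 := huOut _ h1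
    have h3 := hcyc ⟨(i + 1) % L.length, Nat.mod_lt _ i.pos⟩
    rw [h2] at h3
    have h4 := hvOut _ h3
    unfold cycleEdges
    exact ⟨Finset.mem_image.2 ⟨i, Finset.mem_univ _, Prod.ext hi h2⟩,
      Finset.mem_image.2 ⟨_, Finset.mem_univ _, Prod.ext h2 h4⟩⟩
  · exfalso
    have hv : v ∉ L := by
      intro hv
      obtain ⟨j, hj⟩ := List.get_of_mem hv
      have hp := j.pos
      have h1 := hcyc ⟨(j + (L.length - 1)) % L.length, Nat.mod_lt _ hp⟩
      have e : (⟨((j + (L.length - 1)) % L.length + 1) % L.length, Nat.mod_lt _ hp⟩ :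
          Fin L.length) = j := by
        apply Fin.ext
        show ((j + (L.length - 1)) % L.length + 1) % L.length = (j : ℕ)
        rw [Nat.mod_add_mod, show (j : ℕ) + (L.length - 1) + 1 = j + L.length by omega,
          Nat.add_mod_right, Nat.mod_eq_of_lt j.2]
      have h2 : A (L.get ⟨(j + (L.length - 1)) % L.length, Nat.mod_lt _ hp⟩) v := by
        rw [← hj]
        have h3 := congrArg L.get e
        rw [← h3]
        exact h1
      exact hu (hvIn _ h2 ▸ List.get_mem _ _)
    have hne : ∀ i, L.get i ≠ u ∧ L.get i ≠ v := fun i =>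
      ⟨fun h => hu (h ▸ List.get_mem _ _), fun h => hv (h ▸ List.get_mem _ _)⟩
    exact hind ⟨L, ⟨hL.1, hL.2.1, fun i =>
      ⟨hcyc i, (hne _).1, (hne _).2, (hne _).1, (hne _).2⟩⟩, hneg⟩
end

section
/- Let (A, c) be a directed graph on V and let s, u, v ∈ V be pairwise distinct with: v the only out-neighbor of u, s the only out-neighbor of v, and u the only in-neighbor of v. Then the map sending a simple path P from s to u to the simple cycle obtained by appending the edges (u, v) and (v, s) to P is a bijection between the simple paths from s to u and the simple cycles of (A, c) that visit u. Consequently, if there exists at least one simple path from s to u, then the minimum cost of a simple cycle visiting u equals (the minimum cost of a simple path from s to u) + c u v + c v s. -/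
/-!
STATEMENT 7: with `v` the only out-neighbor of `u`, `s` the only out-neighbor
of `v`, and `u` the only in-neighbor of `v`, the map appending the edges
`(u, v)` and `(v, s)` to a simple path from `s` to `u` is a bijection between
the simple paths from `s` to `u` and the simple cycles of `(A, c)` visiting
`u` (cycles being regarded up to rotation, i.e. as elements of `Cycle V`).
Consequently, if a simple path from `s` to `u` exists, the minimum cost of a
simple cycle visiting `u` equals the minimum cost of a simple path from `s`
to `u` plus `c u v + c v s`.
-/

variable {V : Type*}

/-- `L` is a simple path from `a` to `b` in the digraph `A`: a list of
pairwise distinct vertices starting at `a`, ending at `b`, with consecutive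
vertices joined by edges of `A`. -/
def IsSimplePath (A : V → V → Prop) (a b : V) (L : List V) : Prop :=
  L ≠ [] ∧ L.Nodup ∧ L.head? = some a ∧ L.getLast? = some b ∧ L.Chain' A

/-- Cost of a path given by its list of vertices: the sum of `c x y` over
consecutive pairs `(x, y)`. -/
def pathCost (c : V → V → ℝ) (L : List V) : ℝ :=
  ((L.zip L.tail).map fun p => c p.1 p.2).sum

theorem isSimpleCycle_cons_iff (A : V → V → Prop) (a : V) (l : List V) :
    IsSimpleCycle A (a :: l) ↔ (a :: l).Nodup ∧ List.IsChain A (a :: l ++ [a]) := by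
  unfold IsSimpleCycle
  rw [List.isChain_iff_getElem]
  simp only [ne_eq, reduceCtorEq, not_false_eq_true, true_and]
  refine and_congr_right fun _ => ⟨fun h i hi => ?_, fun h i => ?_⟩
  · simp only [List.length_append, List.length_cons, List.length_nil] at hi
    have := h ⟨i, by simp; omega⟩
    rcases Nat.lt_or_ge i l.length with h1 | h1
    · have e : (i + 1) % (l.length + 1) = i + 1 := Nat.mod_eq_of_lt (by omega)
      rw [List.getElem_append_left (by simp; omega), List.getElem_append_left (by simp; omega)]
      simpa [e] using this
    · have e0 : i = l.length := by omega
      subst e0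
      rw [List.getElem_append_left (by simp), List.getElem_append_right (by simp)]
      simpa using this
  · obtain ⟨i, hi⟩ := i
    simp only [List.length_cons] at hi
    have := h i (by simp; omega)
    rcases Nat.lt_or_ge i l.length with h1 | h1
    · have e : (i + 1) % (l.length + 1) = i + 1 := Nat.mod_eq_of_lt (by omega)
      rw [List.getElem_append_left (by simp; omega), List.getElem_append_left (by simp; omega)] at this
      simpa [e] using this
    · have e0 : i = l.length := by omega
      subst e0
      rw [List.getElem_append_left (by simp), List.getElem_append_right (by simp)] at this
      simpa using this

theorem pathCost_cons_cons (c : V → V → ℝ) (a b : V) (l : List V) :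
    pathCost c (a :: b :: l) = c a b + pathCost c (b :: l) := by
  simp [pathCost]

theorem pathCost_append (c : V → V → ℝ) (l : List V) (a b : V) :
    pathCost c (l ++ [a, b]) = pathCost c (l ++ [a]) + c a b := by
  induction l with
  | nil => simp [pathCost]
  | cons x l ih =>
    cases l with
    | nil => simp [pathCost]
    | cons y l =>
      simp only [List.cons_append] at ih ⊢
      rw [pathCost_cons_cons, pathCost_cons_cons, ih]; ring

theorem pathCost_eq_sum (c : V → V → ℝ) (a : V) (l : List V) :
    pathCost c (a :: l) = ∑ i : Fin l.length, c ((a :: l)[i.1]) (l[i.1]) := by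
  induction l generalizing a with
  | nil => simp [pathCost]
  | cons b l ih =>
    rw [pathCost_cons_cons, ih]
    simp only [List.length_cons]
    rw [Fin.sum_univ_succ]
    simp

theorem cycleCost_cons (c : V → V → ℝ) (a : V) (l : List V) :
    cycleCost c (a :: l) = pathCost c (a :: l ++ [a]) := by
  rw [List.cons_append, pathCost_eq_sum]
  unfold cycleCost
  have hl : (a :: l).length = (l ++ [a]).length := by simp
  refine Fintype.sum_equiv (finCongr hl) _ _ ?_
  rintro ⟨i, hi⟩
  simp only [List.length_cons] at hi
  simp only [List.get_eq_getElem, finCongr_apply, Fin.val_cast]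
  congr 1
  · simp only [← List.cons_append]
    rw [List.getElem_append_left]
  · rcases Nat.lt_or_ge i l.length with h1 | h1
    · have e : (i + 1) % (l.length + 1) = i + 1 := Nat.mod_eq_of_lt (by omega)
      rw [List.getElem_append_left h1]
      simp [e]
    · have e0 : i = l.length := by omega
      subst e0
      simp

theorem rotate_one_inv (A : V → V → Prop) (c : V → V → ℝ) (L : List V) (h : IsSimpleCycle A L) :
    IsSimpleCycle A (L.rotate 1) ∧ cycleCost c (L.rotate 1) = cycleCost c L := by
  match L, h with
  | [], h => exact absurd rfl h.1
  | [a], h => simpa using h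
  | a :: b :: l, h =>
    have e : (a :: b :: l).rotate 1 = b :: (l ++ [a]) := by simp
    rw [e, cycleCost_cons, cycleCost_cons]
    rw [isSimpleCycle_cons_iff] at h ⊢
    refine ⟨⟨?_, ?_⟩, ?_⟩
    · rw [← e]; exact List.nodup_rotate.2 h.1
    · have h2 := h.2
      simp only [List.cons_append, List.isChain_cons_cons] at h2
      have := h2.2
      rw [← List.cons_append] at this ⊢
      rw [List.append_assoc]
      rw [List.isChain_append] at this ⊢
      refine ⟨this.1, by simpa using h2.1, by simpa using this.2.2⟩
    · have := pathCost_append c (b :: l) a b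
      simp only [List.cons_append, List.append_assoc, List.nil_append] at this ⊢
      rw [this, pathCost_cons_cons]; ring

theorem rotate_inv (A : V → V → Prop) (c : V → V → ℝ) (n : ℕ) (L : List V)
    (h : IsSimpleCycle A L) :
    IsSimpleCycle A (L.rotate n) ∧ cycleCost c (L.rotate n) = cycleCost c L := by
  induction n with
  | zero => simpa using h
  | succ n ih =>
    rw [← List.rotate_rotate]
    have := rotate_one_inv A c _ ih.1
    exact ⟨this.1, this.2.trans ih.2⟩

theorem path_to_cycle (A : V → V → Prop) (c : V → V → ℝ) (s u v : V)
    (hsv : s ≠ v) (huv : u ≠ v)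
    (hAuv : A u v) (hAvs : A v s) (hvOut : ∀ y, A v y → y = s) (P : List V)
    (hP : IsSimplePath A s u P) :
    IsSimpleCycle A (P ++ [v]) ∧ u ∈ P ++ [v] ∧
      cycleCost c (P ++ [v]) = pathCost c P + c u v + c v s := by
  obtain ⟨hne, hnd, hh, hl, hc⟩ := hP
  have hc : List.IsChain A P := hc
  have hvP : v ∉ P := by
    intro hv
    obtain ⟨P1, P2, rfl⟩ := List.append_of_mem hv
    cases P2 with
    | nil => simp at hl; exact huv hl.symm
    | cons d P2 =>
      have h1 := (List.isChain_append.1 hc).2.1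
      rw [List.isChain_cons_cons] at h1
      have := hvOut _ h1.1
      subst this
      cases P1 with
      | nil => simp at hh; exact hsv hh.symm
      | cons x P1 => simp at hh; subst hh; simp at hnd
  obtain ⟨Q, rfl⟩ : ∃ Q, P = Q ++ [u] := by
    rw [List.getLast?_eq_some_iff] at hl; exact hl
  obtain ⟨R, hR⟩ : ∃ R, Q ++ [u] = s :: R := by
    rw [List.head?_eq_some_iff] at hh; exact hh
  refine ⟨?_, by simp, ?_⟩
  · have e : (Q ++ [u]) ++ [v] = s :: (R ++ [v]) := by rw [hR]; simp
    rw [e, isSimpleCycle_cons_iff, ← e]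
    refine ⟨?_, ?_⟩
    · rw [List.nodup_append]
      refine ⟨hnd, by simp, ?_⟩
      rintro a ha b hb rfl
      simp at hb; subst hb; exact hvP ha
    · rw [List.append_assoc, List.isChain_append]
      refine ⟨hc, by simpa using hAvs, by simpa using hAuv⟩
  · have e : (Q ++ [u]) ++ [v] = s :: (R ++ [v]) := by rw [hR]; simp
    rw [e, cycleCost_cons, ← e]
    have h1 := pathCost_append c (Q ++ [u]) v s
    have h2 := pathCost_append c Q u v
    simp only [List.append_assoc, List.cons_append, List.nil_append] at h1 h2 ⊢
    rw [h1, h2]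

theorem cycle_to_path (A : V → V → Prop) (s u v : V)
    (hsu : s ≠ u) (huv : u ≠ v)
    (huOut : ∀ y, A u y → y = v) (hvOut : ∀ y, A v y → y = s) (L : List V)
    (hL : IsSimpleCycle A L) (hu : u ∈ L) :
    ∃ P n, IsSimplePath A s u P ∧ L.rotate n = P ++ [v] := by
  obtain ⟨L1, L2, rfl⟩ := List.append_of_mem hu
  have h := (rotate_inv A (fun _ _ => 0) L1.length _ hL).1
  have e0 := List.rotate_append_length_eq L1 (u :: L2)
  rw [e0, List.cons_append, isSimpleCycle_cons_iff] at h
  obtain ⟨hnd, hc⟩ := h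
  rw [List.cons_append] at e0
  generalize L2 ++ L1 = l at *
  match l, hnd, hc, e0 with
  | [], hnd, hc, e0 => simp at hc; exact absurd (huOut _ hc) huv
  | [b], hnd, hc, e0 =>
    simp at hc
    obtain rfl := huOut _ hc.1
    exact absurd (hvOut _ hc.2).symm hsu
  | b :: d :: l, hnd, hc, e0 =>
    simp only [List.cons_append, List.isChain_cons_cons] at hc
    obtain ⟨h1, h2, h3⟩ := hc
    obtain rfl := huOut _ h1
    obtain rfl := hvOut _ h2
    refine ⟨d :: (l ++ [u]), L1.length + 2, ⟨by simp, ?_, by simp, ?_, h3⟩, ?_⟩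
    · simp only [List.nodup_cons, List.mem_cons, List.nodup_append, List.mem_append] at hnd ⊢
      simp
      grind
    · rw [← List.cons_append, List.getLast?_append]; simp
    · rw [← List.rotate_rotate, e0]; simp [List.rotate_cons_succ]

theorem cons_isRotated_inj (v : V) (P Q : List V) (hnd : (v :: P).Nodup)
    (h : (v :: P) ~r (v :: Q)) : P = Q := by
  obtain ⟨n, hn, e⟩ := List.isRotated_iff_mod.1 h
  rcases Nat.eq_or_lt_of_le hn with hn | hn
  · rw [hn, List.rotate_length] at e; simpa using e
  · have h0 : ((v :: P).rotate n)[0]? = some v := by rw [e]; simp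
    rw [List.getElem?_rotate (by simp)] at h0
    rw [Nat.zero_add, Nat.mod_eq_of_lt hn, List.getElem?_eq_getElem hn] at h0
    have h1 : (v :: P)[n] = (v :: P)[0] := by simpa using h0
    have := (hnd.getElem_inj_iff).1 h1
    subst this
    simpa using e

theorem paths_biject_with_cycles_through_u [Fintype V] [DecidableEq V]
    (A : V → V → Prop) (c : V → V → ℝ) (s u v : V)
    (hsu : s ≠ u) (hsv : s ≠ v) (huv : u ≠ v)
    (hAuv : A u v) (huOut : ∀ y, A u y → y = v)
    (hAvs : A v s) (hvOut : ∀ y, A v y → y = s)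
    (hvIn : ∀ y, A y v → y = u) :
    Set.BijOn (fun P : List V => (↑(P ++ [v]) : Cycle V))
      {P : List V | IsSimplePath A s u P}
      {C : Cycle V | ∃ L : List V, IsSimpleCycle A L ∧ u ∈ L ∧ (↑L : Cycle V) = C} ∧
    ((∃ P : List V, IsSimplePath A s u P) →
      sInf {x : ℝ | ∃ L : List V, IsSimpleCycle A L ∧ u ∈ L ∧ cycleCost c L = x} =
        sInf {x : ℝ | ∃ P : List V, IsSimplePath A s u P ∧ pathCost c P = x}
          + c u v + c v s) := by
  have p2c := path_to_cycle A c s u v hsv huv hAuv hAvs hvOut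
  have c2p := cycle_to_path A s u v hsu huv huOut hvOut
  refine ⟨⟨?_, ?_, ?_⟩, ?_⟩
  · intro P hP
    exact ⟨P ++ [v], (p2c P hP).1, (p2c P hP).2.1, rfl⟩
  · intro P hP Q hQ h
    have h : (P ++ [v]) ~r (Q ++ [v]) := Cycle.coe_eq_coe.1 h
    have hP1 : (v :: P) ~r (P ++ [v]) := ⟨1, by simp⟩
    have hQ1 : (v :: Q) ~r (Q ++ [v]) := ⟨1, by simp⟩
    refine cons_isRotated_inj v P Q ?_ ((hP1.trans h).trans hQ1.symm)
    exact hP1.nodup_iff.2 (p2c P hP).1.2.1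
  · rintro C ⟨L, hL, hu, rfl⟩
    obtain ⟨P, n, hP, e⟩ := c2p L hL hu
    exact ⟨P, hP, (Cycle.coe_eq_coe.2 ⟨n, e⟩).symm⟩
  · rintro ⟨P0, hP0⟩
    have hset : {x : ℝ | ∃ L : List V, IsSimpleCycle A L ∧ u ∈ L ∧ cycleCost c L = x} =
        (fun x => x + (c u v + c v s)) ''
          {x : ℝ | ∃ P : List V, IsSimplePath A s u P ∧ pathCost c P = x} := by
      ext x
      constructor
      · rintro ⟨L, hL, hu, rfl⟩
        obtain ⟨P, n, hP, e⟩ := c2p L hL hu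
        refine ⟨_, ⟨P, hP, rfl⟩, ?_⟩
        have h1 := (rotate_inv A c n L hL).2
        rw [e, (p2c P hP).2.2] at h1
        simp only; linarith
      · rintro ⟨_, ⟨P, hP, rfl⟩, rfl⟩
        refine ⟨_, (p2c P hP).1, (p2c P hP).2.1, ?_⟩
        rw [(p2c P hP).2.2]; ring
    have hfin : {x : ℝ | ∃ P : List V, IsSimplePath A s u P ∧ pathCost c P = x}.Finite := by
      have hf : {P : List V | P.length ≤ Fintype.card V}.Finite := List.finite_length_le V _
      refine (hf.image (pathCost c)).subset ?_
      rintro x ⟨P, hP, rfl⟩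
      exact ⟨P, hP.2.1.length_le_card, rfl⟩
    rw [hset, add_assoc]
    have hne : {x : ℝ | ∃ P : List V, IsSimplePath A s u P ∧ pathCost c P = x}.Nonempty :=
      ⟨_, P0, hP0, rfl⟩
    exact ((OrderIso.addRight (c u v + c v s)).map_csInf' hne hfin.bddBelow).symm
end

section
/- Let f be a feasible circulation and let Γ be a simple cycle of the residual graph of f. Then the augmentation f′ of f along Γ is again a feasible circulation, i.e., f′ x y ≤ cap x y for all x, y, and ∑_y f′ x y = ∑_y f′ y x for every x. -/
/-!
STATEMENT 8: augmenting a feasible circulation `f` along a simple cycle of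
its residual graph yields again a feasible circulation.
-/

variable {V : Type*}

theorem cyc_succ_bij (n : ℕ) :
    Function.Bijective (fun i : Fin n => (⟨(i + 1) % n, Nat.mod_lt _ i.pos⟩ : Fin n)) := by
  apply Finite.injective_iff_bijective.mp
  intro i j h
  have h' : ((i : ℕ) + 1) % n = ((j : ℕ) + 1) % n := congrArg Fin.val h
  have h2 : (i : ℕ) ≡ j [MOD n] := Nat.ModEq.add_right_cancel' 1 h'
  exact Fin.ext (h2.eq_of_lt_of_lt i.2 j.2)

theorem cyc_ind [DecidableEq V] (L : List V) (hL : L.Nodup) (x y : V) :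
    (if (x, y) ∈ cycleEdges L then 1 else 0 : ℤ) =
      ∑ i : Fin L.length, if L.get i = x ∧
        L.get ⟨(i + 1) % L.length, Nat.mod_lt _ i.pos⟩ = y then 1 else 0 := by
  have hinj : Function.Injective L.get := List.nodup_iff_injective_get.mp hL
  split_ifs with h
  · simp only [cycleEdges, Finset.mem_image, Finset.mem_univ, true_and, Prod.mk.injEq] at h
    obtain ⟨i, hi, hi'⟩ := h
    rw [Finset.sum_eq_single i]
    · rw [if_pos ⟨hi, hi'⟩]
    · intro j _ hj
      rw [if_neg]
      rintro ⟨h1, -⟩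
      exact hj (hinj (h1.trans hi.symm))
    · simp
  · symm
    apply Finset.sum_eq_zero
    intro i _
    rw [if_neg]
    intro hi
    apply h
    simp only [cycleEdges, Finset.mem_image, Finset.mem_univ, true_and, Prod.mk.injEq]
    exact ⟨i, hi⟩

theorem cyc_deg [Fintype V] [DecidableEq V] (L : List V) (hL : L.Nodup) (x : V) :
    ∑ y, (if (x, y) ∈ cycleEdges L then 1 else 0 : ℤ) =
      ∑ y, (if (y, x) ∈ cycleEdges L then 1 else 0 : ℤ) := by
  simp only [cyc_ind L hL]
  rw [Finset.sum_comm]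
  conv_rhs => rw [Finset.sum_comm]
  simp only [ite_and, Finset.sum_ite_eq, Finset.mem_univ, if_true]
  have h1 : ∀ i : Fin L.length, ∑ y, (if L.get i = x then
      if L.get ⟨(i + 1) % L.length, Nat.mod_lt _ i.pos⟩ = y then 1 else 0 else 0 : ℤ) =
      if L.get i = x then 1 else 0 := by
    intro i
    split_ifs <;> simp
  simp only [h1]
  exact ((cyc_succ_bij L.length).sum_comp
    (fun i => if L.get i = x then (1 : ℤ) else 0)).symm

theorem augment_is_feasible [Fintype V] [DecidableEq V]
    (c : V → V → ℝ) (cap : V → V → ℕ)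
    (hloop : ∀ x, cap x x = 0)
    (hanti : ∀ x y, x ≠ y → cap x y = 0 ∨ cap y x = 0)
    (f : V → V → ℕ) (hf : IsCirculation cap f)
    (Γ : List V) (hΓ : IsSimpleCycle (ResAdj cap f) Γ) :
    IsCirculation cap (augment cap f Γ) := by
  obtain ⟨hcap, hcons⟩ := hf
  obtain ⟨-, hnd, hadj⟩ := hΓ
  have hE : ∀ x y, (x, y) ∈ cycleEdges Γ → ResAdj cap f x y := by
    intro x y h
    simp only [cycleEdges, Finset.mem_image, Finset.mem_univ, true_and, Prod.mk.injEq] at h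
    obtain ⟨i, rfl, rfl⟩ := h
    exact hadj i
  refine ⟨fun x y => ?_, fun x => ?_⟩
  · have := hcap x y
    unfold augment
    split_ifs <;> omega
  · let a : V → V → ℤ := fun x y => if (x, y) ∈ cycleEdges Γ ∧ f x y < cap x y then 1 else 0
    let b : V → V → ℤ := fun x y => if (y, x) ∈ cycleEdges Γ ∧ 0 < f x y then 1 else 0
    have haug : ∀ x y, (augment cap f Γ x y : ℤ) = f x y + a x y - b x y := by
      intro x y
      simp only [augment, a, b]
      split_ifs <;> omega
    have hab : ∀ x y, a x y + b y x = if (x, y) ∈ cycleEdges Γ then 1 else 0 := by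
      intro x y
      simp only [a, b]
      by_cases h : (x, y) ∈ cycleEdges Γ
      · have h1 := hE x y h
        have h2 := hcap x y
        have h3 := hcap y x
        have h4 : cap x y = 0 ∨ cap y x = 0 := by
          by_cases hxy : x = y
          · subst hxy; exact Or.inl (hloop x)
          · exact hanti x y hxy
        unfold ResAdj at h1
        simp only [h, true_and, if_true]
        split_ifs <;> omega
      · simp [h]
    have hd := cyc_deg Γ hnd x
    simp only [← hab, Finset.sum_add_distrib] at hd
    have hc : ∑ y, (f x y : ℤ) = ∑ y, (f y x : ℤ) := by exact_mod_cast hcons x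
    have : ∑ y, (augment cap f Γ x y : ℤ) = ∑ y, (augment cap f Γ y x : ℤ) := by
      simp only [haug, Finset.sum_add_distrib, Finset.sum_sub_distrib]
      linarith
    exact_mod_cast this
end

section
/- Let f be a feasible circulation and let Γ be a simple cycle of the residual graph of f. Then the augmentation f′ of f along Γ satisfies cost(f′) = cost(f) + cost(Γ), where cost(Γ) is the sum of the residual costs of the edges traversed by Γ. -/
/-!
STATEMENT 9: augmenting a feasible circulation `f` along a simple cycle `Γ`
of its residual graph changes the cost by exactly the (residual) cost of `Γ`:
`cost f' = cost f + cost Γ`.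
-/

variable {V : Type*}

theorem augment_cost [Fintype V] [DecidableEq V]
    (c : V → V → ℝ) (cap : V → V → ℕ)
    (hloop : ∀ x, cap x x = 0)
    (hanti : ∀ x y, x ≠ y → cap x y = 0 ∨ cap y x = 0)
    (f : V → V → ℕ) (hf : IsCirculation cap f)
    (Γ : List V) (hΓ : IsSimpleCycle (ResAdj cap f) Γ) :
    flowCost c (augment cap f Γ) = flowCost c f + cycleCost (resCost c f) Γ := by
  obtain ⟨hcap, -⟩ := hf
  obtain ⟨-, hnd, hadj⟩ := hΓ
  have hE : ∀ x y, (x, y) ∈ cycleEdges Γ → ResAdj cap f x y := by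
    intro x y h
    simp only [cycleEdges, Finset.mem_image, Finset.mem_univ, true_and, Prod.mk.injEq] at h
    obtain ⟨i, rfl, rfl⟩ := h
    exact hadj i
  have hcost : cycleCost (resCost c f) Γ
      = ∑ x, ∑ y, if (x, y) ∈ cycleEdges Γ then resCost c f x y else 0 := by
    rw [← Fintype.sum_prod_type'
      (f := fun x y => if (x, y) ∈ cycleEdges Γ then resCost c f x y else 0)]
    simp only [Prod.mk.eta]
    rw [Finset.sum_ite_mem, Finset.univ_inter]
    unfold cycleEdges cycleCost
    rw [Finset.sum_image]
    intro i _ j _ h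
    exact (List.nodup_iff_injective_get.mp hnd) (Prod.mk.inj h).1
  have haug : ∀ x y, c x y * (augment cap f Γ x y : ℝ) = c x y * (f x y : ℝ)
      + (if (x, y) ∈ cycleEdges Γ ∧ f x y < cap x y then c x y else 0)
      - (if (y, x) ∈ cycleEdges Γ ∧ 0 < f x y then c x y else 0) := by
    intro x y
    unfold augment
    rw [Nat.cast_sub (by split_ifs <;> omega)]
    push_cast
    split_ifs <;> ring
  unfold flowCost
  simp only [haug, Finset.sum_add_distrib, Finset.sum_sub_distrib]
  rw [Finset.sum_comm (f := fun x y =>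
    if (y, x) ∈ cycleEdges Γ ∧ 0 < f x y then c x y else 0), hcost, add_sub_assoc]
  congr 1
  simp only [← Finset.sum_sub_distrib]
  refine Finset.sum_congr rfl fun x _ => Finset.sum_congr rfl fun y _ => ?_
  by_cases h : (x, y) ∈ cycleEdges Γ
  · have h1 := hE x y h
    unfold ResAdj at h1
    have h2 := hcap y x
    by_cases h3 : 0 < f y x
    · have h4 : x ≠ y := by
        rintro rfl
        have := hloop x
        omega
      have h5 : ¬ f x y < cap x y := by
        have := hanti x y h4
        omega
      simp [h, h3, h5, resCost]
    · have h5 : f x y < cap x y := by omega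
      simp only [h, h3, h5, resCost]
      simp
  · simp [h]
end

section
/- Assume unit capacities (cap x y ≤ 1 for all x, y) and let f and f′ be two feasible circulations. Then there exist pairwise edge-disjoint simple cycles Γ₁, …, Γ_m of the residual graph of f such that for all x, y: f′ x y − f x y equals (the number of indices i for which Γᵢ traverses the forward residual edge x → y) minus (the number of indices i for which Γᵢ traverses the backward residual edge y → x), and moreover cost(f′) = cost(f) + ∑_{i=1}^{m} cost(Γᵢ). -/
/-!
STATEMENT 11: under unit capacities, the difference of two feasible
circulations `f'` and `f` decomposes into pairwise edge-disjoint simple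
cycles of the residual graph of `f`, and
`cost f' = cost f + ∑ᵢ cost Γᵢ`.
-/

variable {V : Type*}

theorem aux_sum_edges [DecidableEq V] {M : Type*} [AddCommMonoid M] (L : List V) (hL : L.Nodup)
    (F : V × V → M) :
    ∑ e ∈ cycleEdges L, F e = ∑ i : Fin L.length,
      F (L.get i, L.get ⟨(i + 1) % L.length, Nat.mod_lt _ i.pos⟩) := by
  unfold cycleEdges
  rw [Finset.sum_image]
  intro i _ j _ h
  exact (List.nodup_iff_injective_get.mp hL) (congrArg Prod.fst h)

/-- Balancedness of an edge set. -/
def AuxBal (D : Finset (V × V)) : Prop := ∀ g : V → ℤ, ∑ e ∈ D, g e.1 = ∑ e ∈ D, g e.2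

theorem aux_bal_cycle [DecidableEq V] (L : List V) (hL : L.Nodup) : AuxBal (cycleEdges L) := by
  intro g
  rw [aux_sum_edges L hL (fun e => g e.1), aux_sum_edges L hL (fun e => g e.2)]
  obtain ⟨n, hn⟩ : ∃ n, n = L.length := ⟨_, rfl⟩
  cases n with
  | zero =>
    have : IsEmpty (Fin L.length) := by rw [← hn]; infer_instance
    simp
  | succ n =>
    have : NeZero L.length := ⟨by omega⟩
    rw [← Equiv.sum_comp (Equiv.addRight (1 : Fin L.length)) (fun i => g (L.get i))]
    refine Finset.sum_congr rfl fun i _ => ?_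
    congr 2
    ext
    simp [Fin.val_add]

theorem aux_find_cycle [Fintype V] [DecidableEq V] (D : Finset (V × V)) (hD : AuxBal D)
    (hne : D.Nonempty) : ∃ L : List V, IsSimpleCycle (fun x y => (x, y) ∈ D) L := by
  classical
  have key : ∀ x y, (x, y) ∈ D → ∃ z, (y, z) ∈ D := by
    intro x y hxy
    by_contra hcon
    push Not at hcon
    have h := hD (fun v => if v = y then 1 else 0)
    have h1 : ∑ e ∈ D, (if e.1 = y then (1 : ℤ) else 0) = 0 := by
      refine Finset.sum_eq_zero fun e he => ?_
      rw [if_neg]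
      rintro rfl
      exact hcon e.2 he
    have h2 : 0 < ∑ e ∈ D, (if e.2 = y then (1 : ℤ) else 0) := by
      refine Finset.sum_pos' (fun e _ => by split_ifs <;> norm_num) ⟨(x, y), hxy, by simp⟩
    omega
  choose! nx' hnx' using key
  obtain ⟨⟨a, b⟩, hab⟩ := hne
  have key2 : ∃ nx : V → V, ∀ x, (∃ y, (x, y) ∈ D) → (x, nx x) ∈ D := by
    refine ⟨fun x => if h : ∃ y, (x, y) ∈ D then h.choose else x, fun x h => ?_⟩
    simp only [dif_pos h]
    exact h.choose_spec
  obtain ⟨nx, hnx⟩ := key2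
  have hit : ∀ n : ℕ, (nx^[n] a, nx^[n+1] a) ∈ D := by
    intro n
    induction n with
    | zero => exact hnx a ⟨b, hab⟩
    | succ n ih =>
      rw [Function.iterate_succ_apply' nx (n+1)]
      exact hnx _ ⟨_, hnx' _ _ ih⟩
  obtain ⟨i, j, hij, heq⟩ := Finite.exists_ne_map_eq_of_infinite (fun n : ℕ => nx^[n] a)
  wlog hlt : i < j generalizing i j
  · exact this j i hij.symm heq.symm (by omega)
  have hper : Function.IsPeriodicPt nx (j - i) (nx^[i] a) := by
    unfold Function.IsPeriodicPt Function.IsFixedPt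
    rw [← Function.iterate_add_apply, Nat.sub_add_cancel hlt.le, heq]
  set p := nx^[i] a with hp
  have hpos : 0 < Function.minimalPeriod nx p := hper.minimalPeriod_pos (by omega)
  refine ⟨(List.range (Function.minimalPeriod nx p)).map (fun k => nx^[k] p), ?_, ?_, ?_⟩
  · simp; omega
  · refine List.Nodup.map_on ?_ List.nodup_range
    intro x hx y hy hxy
    exact Function.iterate_injOn_Iio_minimalPeriod (f := nx) (x := p)
      (List.mem_range.mp hx) (List.mem_range.mp hy) hxy
  · intro k
    simp only [List.get_eq_getElem, List.getElem_map, List.getElem_range, List.length_map,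
      List.length_range, Function.iterate_mod_minimalPeriod_eq]
    have := hit (k + i)
    rw [show (k : ℕ) + i + 1 = (k + 1) + i by omega, Function.iterate_add_apply nx k i,
      Function.iterate_add_apply nx (k+1) i] at this
    exact this

theorem aux_decomp [Fintype V] [DecidableEq V] : ∀ (n : ℕ) (D : Finset (V × V)), D.card = n →
    AuxBal D → ∃ S : Finset (List V), (∀ L ∈ S, IsSimpleCycle (fun x y => (x, y) ∈ D) L) ∧
      (S : Set (List V)).PairwiseDisjoint cycleEdges ∧ S.biUnion cycleEdges = D := by
  intro n
  induction n using Nat.strong_induction_on with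
  | _ n ih =>
    intro D hn hD
    by_cases hne : D.Nonempty
    · obtain ⟨L, hL⟩ := aux_find_cycle D hD hne
      have hsub : cycleEdges L ⊆ D := by
        intro e he
        unfold cycleEdges at he
        obtain ⟨i, _, rfl⟩ := Finset.mem_image.mp he
        exact hL.2.2 i
      have hLne : (cycleEdges L).Nonempty := by
        have : 0 < L.length := List.length_pos_iff.mpr hL.1
        unfold cycleEdges
        exact ⟨_, Finset.mem_image_of_mem _ (Finset.mem_univ ⟨0, this⟩)⟩
      have hcard : (D \ cycleEdges L).card < n := by
        rw [← hn]
        exact Finset.card_lt_card (Finset.sdiff_ssubset hsub hLne)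
      obtain ⟨S, h1, h2, h3⟩ := ih _ hcard (D \ cycleEdges L) rfl (by
        intro g
        have a1 := Finset.sum_sdiff (f := fun e : V × V => g e.1) hsub
        have a2 := Finset.sum_sdiff (f := fun e : V × V => g e.2) hsub
        have a3 := hD g
        have a4 := aux_bal_cycle L hL.2.1 g
        linarith)
      refine ⟨insert L S, ?_, ?_, ?_⟩
      · intro K hK
        rcases Finset.mem_insert.mp hK with rfl | hK
        · exact hL
        · obtain ⟨b1, b2, b3⟩ := h1 K hK
          exact ⟨b1, b2, fun i => (Finset.mem_sdiff.mp (b3 i)).1⟩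
      · rw [Finset.coe_insert]
        refine h2.insert fun K hK _ => ?_
        have : cycleEdges K ⊆ D \ cycleEdges L := by
          rw [← h3]; exact Finset.subset_biUnion_of_mem cycleEdges hK
        exact Finset.disjoint_sdiff.mono_right this
      · rw [Finset.biUnion_insert, h3]
        exact Finset.union_sdiff_of_subset hsub
    · rw [Finset.not_nonempty_iff_eq_empty] at hne
      subst hne
      exact ⟨∅, by simp, by simp, by simp⟩

theorem circulation_difference_decomposition [Fintype V] [DecidableEq V]
    (c : V → V → ℝ) (cap : V → V → ℕ)
    (hloop : ∀ x, cap x x = 0)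
    (hanti : ∀ x y, x ≠ y → cap x y = 0 ∨ cap y x = 0)
    (hunit : ∀ x y, cap x y ≤ 1)
    (f f' : V → V → ℕ)
    (hf : IsCirculation cap f) (hf' : IsCirculation cap f') :
    ∃ (m : ℕ) (Γ : Fin m → List V),
      (∀ i, IsSimpleCycle (ResAdj cap f) (Γ i)) ∧
      (∀ i j, i ≠ j → Disjoint (cycleEdges (Γ i)) (cycleEdges (Γ j))) ∧
      (∀ x y, (f' x y : ℤ) - (f x y : ℤ) =
        ((Finset.univ.filter
            (fun i : Fin m => (x, y) ∈ cycleEdges (Γ i) ∧ f x y < cap x y)).card : ℤ) -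
          ((Finset.univ.filter
            (fun i : Fin m => (y, x) ∈ cycleEdges (Γ i) ∧ 0 < f x y)).card : ℤ)) ∧
      flowCost c f' = flowCost c f + ∑ i, cycleCost (resCost c f) (Γ i) := by
  have hanti' : ∀ x y, cap x y = 0 ∨ cap y x = 0 := by
    intro x y
    by_cases h : x = y
    · subst h; exact Or.inl (hloop x)
    · exact hanti x y h
  obtain ⟨hfc, hfb⟩ := hf
  obtain ⟨hfc', hfb'⟩ := hf'
  let D : Finset (V × V) := Finset.univ.filter (fun e => f e.1 e.2 < f' e.1 e.2 ∨
    f' e.2 e.1 < f e.2 e.1)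
  have hmem : ∀ x y, (x, y) ∈ D ↔ (f x y < f' x y ∨ f' y x < f y x) := by
    intro x y; simp [D]
  have hDsum : ∀ {M : Type} [AddCommMonoid M] (F : V → V → M), ∑ e ∈ D, F e.1 e.2 =
      ∑ x, ∑ y, if (x, y) ∈ D then F x y else 0 := by
    intro M _ F
    rw [← Fintype.sum_prod_type' (f := fun x y => if (x, y) ∈ D then F x y else 0)]
    simp
  have hbal : AuxBal D := by
    intro g
    rw [hDsum (fun x _ => g x), hDsum (fun _ y => g y)]
    rw [Finset.sum_comm (f := fun x y => if (x, y) ∈ D then g y else 0), ← sub_eq_zero,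
      ← Finset.sum_sub_distrib]
    refine Finset.sum_eq_zero fun x _ => ?_
    rw [← Finset.sum_sub_distrib]
    have e1 : ∀ y, ((if (x, y) ∈ D then g x else 0) - (if (y, x) ∈ D then g x else 0)) =
        g x * (((f' x y : ℤ) - f' y x) - ((f x y : ℤ) - f y x)) := by
      intro y
      have u1 := hunit x y
      have u2 := hunit y x
      have a1 := hfc x y
      have a2 := hfc y x
      have a3 := hfc' x y
      have a4 := hfc' y x
      have a5 := hanti' x y
      simp only [hmem]
      have : (((f' x y : ℤ) - f' y x) - ((f x y : ℤ) - f y x)) =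
        (if f x y < f' x y ∨ f' y x < f y x then 1 else 0) -
        (if f y x < f' y x ∨ f' x y < f x y then 1 else 0) := by
        split_ifs <;> omega
      rw [this]
      split_ifs <;> ring
    rw [Finset.sum_congr rfl (fun y _ => e1 y), ← Finset.mul_sum]
    have b1 : ∑ y, (f x y : ℤ) = ∑ y, (f y x : ℤ) := by exact_mod_cast hfb x
    have b2 : ∑ y, (f' x y : ℤ) = ∑ y, (f' y x : ℤ) := by exact_mod_cast hfb' x
    simp only [Finset.sum_sub_distrib, b1, b2, sub_self, mul_zero]
  obtain ⟨S, h1, h2, h3⟩ := aux_decomp _ D rfl hbal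
  let E := S.equivFin.symm
  have hinj : ∀ i j, i ≠ j → Disjoint (cycleEdges (E i).1) (cycleEdges (E j).1) := by
    intro i j hij
    refine h2 (E i).2 (E j).2 fun h => hij (E.injective (Subtype.ext h))
  have hcount : ∀ e, (Finset.univ.filter (fun i => e ∈ cycleEdges (E i).1)).card =
      if e ∈ D then 1 else 0 := by
    intro e
    split_ifs with he
    · rw [← h3] at he
      obtain ⟨L, hL, heL⟩ := Finset.mem_biUnion.mp he
      rw [Finset.card_eq_one]
      refine ⟨E.symm ⟨L, hL⟩, ?_⟩
      ext i
      simp only [Finset.mem_filter, Finset.mem_univ, true_and, Finset.mem_singleton]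
      constructor
      · intro hi
        by_contra hne
        refine Finset.disjoint_left.mp (hinj _ _ hne) hi ?_
        simpa using heL
      · rintro rfl
        simpa using heL
    · rw [Finset.card_eq_zero, Finset.filter_eq_empty_iff]
      intro i _ hi
      apply he
      rw [← h3]
      exact Finset.mem_biUnion.mpr ⟨_, (E i).2, hi⟩
  have hcount2 : ∀ e (P : Prop) [Decidable P],
      (Finset.univ.filter (fun i => e ∈ cycleEdges (E i).1 ∧ P)).card =
      if e ∈ D ∧ P then 1 else 0 := by
    intro e P _
    by_cases hP : P
    · simp only [hP, and_true]; exact hcount e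
    · simp [hP]
  refine ⟨S.card, fun i => (E i).1, ?_, hinj, ?_, ?_⟩
  · intro i
    obtain ⟨b1, b2, b3⟩ := h1 _ (E i).2
    refine ⟨b1, b2, fun k => ?_⟩
    have := (hmem _ _).mp (b3 k)
    unfold ResAdj
    rcases this with h | h
    · exact Or.inl (h.trans_le (hfc' _ _))
    · exact Or.inr (Nat.zero_lt_of_lt h)
  · intro x y
    rw [hcount2, hcount2]
    simp only [hmem]
    have u1 := hunit x y
    have u2 := hunit y x
    have a1 := hfc x y
    have a2 := hfc y x
    have a3 := hfc' x y
    have a4 := hfc' y x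
    have a5 := hanti' x y
    split_ifs <;> push_cast <;> omega
  · have s1 : ∑ i, cycleCost (resCost c f) (E i).1 = ∑ e ∈ D, resCost c f e.1 e.2 := by
      rw [← h3, Finset.sum_biUnion h2, ← Finset.sum_coe_sort S, ← Equiv.sum_comp E]
      refine Finset.sum_congr rfl fun i _ => ?_
      rw [aux_sum_edges _ (h1 _ (E i).2).2.1 (fun e => resCost c f e.1 e.2)]
      rfl
    rw [s1, hDsum (fun x y => resCost c f x y)]
    have e1 : ∀ x y, (if (x, y) ∈ D then resCost c f x y else 0) =
        (if f x y < f' x y then c x y else 0) - (if f' y x < f y x then c y x else 0) := by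
      intro x y
      have u1 := hunit x y
      have u2 := hunit y x
      have a1 := hfc x y
      have a2 := hfc y x
      have a3 := hfc' x y
      have a4 := hfc' y x
      have a5 := hanti' x y
      simp only [hmem, resCost]
      split_ifs <;> first | omega | simp
    simp only [e1, Finset.sum_sub_distrib]
    rw [Finset.sum_comm (f := fun x y => if f' y x < f y x then c y x else 0)]
    unfold flowCost
    rw [← Finset.sum_sub_distrib, ← Finset.sum_add_distrib]
    refine Finset.sum_congr rfl fun x _ => ?_
    rw [← Finset.sum_sub_distrib, ← Finset.sum_add_distrib]
    refine Finset.sum_congr rfl fun y _ => ?_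
    have u1 := hunit x y
    have a1 := hfc x y
    have a3 := hfc' x y
    have c1 : f x y = 0 ∨ f x y = 1 := by omega
    have c2 : f' x y = 0 ∨ f' x y = 1 := by omega
    rcases c1 with c1 | c1 <;> rcases c2 with c2 | c2 <;> simp [c1, c2]
end
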